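/- arXiv:1403.2117 — 9 statements merged into one kernel-verified Lean document; each statement's English description precedes it below -/
import Mathlib

section
/- Let U be a finite-dimensional real inner product space and let A and B be self-adjoint linear operators on U. If A is positive-semidefinite and B is positive-definite on the kernel of A (i.e., ⟨Bv, v⟩ > 0 for every nonzero v ∈ ker A), then there exists ε₀ > 0 such that A + εB is positive-definite for all ε with 0 < ε < ε₀. -/
/- Common setup: an abstract model of the second and fourth exterior powers
`Λ²V` and `Λ⁴V` of a real inner product space `V`, with the induced inner
products, the identification of 4-vectors with self-adjoint operators on
`Λ²V`, and the Bianchi map. -/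

noncomputable section

open scoped InnerProductSpace

/-- A linear operator on a real inner product space is positive-semidefinite. -/
def IsPosSemidef {E : Type*} [NormedAddCommGroup E] [InnerProductSpace ℝ E]
    (T : E →ₗ[ℝ] E) : Prop :=
  ∀ v : E, 0 ≤ ⟪T v, v⟫_ℝ

/-- A linear operator on a real inner product space is positive-definite. -/
def IsPosDef {E : Type*} [NormedAddCommGroup E] [InnerProductSpace ℝ E]
    (T : E →ₗ[ℝ] E) : Prop :=
  ∀ v : E, v ≠ 0 → 0 < ⟪T v, v⟫_ℝ

/-- An abstract model of the exterior powers `Λ²V` (the type `E2`) and `Λ⁴V`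
(the type `E4`) of a real inner product space `V`:
* `wedge2 X Y` models `X ∧ Y ∈ Λ²V` and `wedge4 X Y Z W` models
  `X ∧ Y ∧ Z ∧ W ∈ Λ⁴V`; both are alternating, and their images span.
* The inner products are the induced ones, given by Gram determinants.
* `wedge22` models the wedge product `Λ²V × Λ²V → Λ⁴V`.
* `toOp ω` is the self-adjoint operator on `Λ²V` associated to `ω ∈ Λ⁴V`,
  determined by `⟪toOp ω (X ∧ Y), Z ∧ W⟫ = ω(X,Y,Z,W) = ⟪ω, X ∧ Y ∧ Z ∧ W⟫`
  (using the identification of `Λ⁴V` with 4-forms via the inner product). -/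
structure ExtModel (V E2 E4 : Type*)
    [NormedAddCommGroup V] [InnerProductSpace ℝ V]
    [NormedAddCommGroup E2] [InnerProductSpace ℝ E2]
    [NormedAddCommGroup E4] [InnerProductSpace ℝ E4] where
  wedge2 : V →ₗ[ℝ] V →ₗ[ℝ] E2
  wedge4 : V →ₗ[ℝ] V →ₗ[ℝ] V →ₗ[ℝ] V →ₗ[ℝ] E4
  wedge22 : E2 →ₗ[ℝ] E2 →ₗ[ℝ] E4
  toOp : E4 →ₗ[ℝ] E2 →ₗ[ℝ] E2
  wedge2_self : ∀ X : V, wedge2 X X = 0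
  wedge4_self₁₂ : ∀ X Z W : V, wedge4 X X Z W = 0
  wedge4_self₂₃ : ∀ X Y W : V, wedge4 X Y Y W = 0
  wedge4_self₃₄ : ∀ X Y Z : V, wedge4 X Y Z Z = 0
  span_wedge2 : Submodule.span ℝ {σ : E2 | ∃ X Y : V, σ = wedge2 X Y} = ⊤
  span_wedge4 : Submodule.span ℝ {ω : E4 | ∃ X Y Z W : V, ω = wedge4 X Y Z W} = ⊤
  inner_wedge2 : ∀ X Y Z W : V,
    ⟪wedge2 X Y, wedge2 Z W⟫_ℝ = ⟪X, Z⟫_ℝ * ⟪Y, W⟫_ℝ - ⟪X, W⟫_ℝ * ⟪Y, Z⟫_ℝ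
  inner_wedge4 : ∀ x y : Fin 4 → V,
    ⟪wedge4 (x 0) (x 1) (x 2) (x 3), wedge4 (y 0) (y 1) (y 2) (y 3)⟫_ℝ
      = Matrix.det (Matrix.of fun i j : Fin 4 => ⟪x i, y j⟫_ℝ)
  wedge22_spec : ∀ X Y Z W : V, wedge22 (wedge2 X Y) (wedge2 Z W) = wedge4 X Y Z W
  toOp_spec : ∀ (ω : E4) (X Y Z W : V),
    ⟪toOp ω (wedge2 X Y), wedge2 Z W⟫_ℝ = ⟪ω, wedge4 X Y Z W⟫_ℝ

namespace ExtModel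

variable {V E2 E4 : Type*} [NormedAddCommGroup V] [InnerProductSpace ℝ V]
  [NormedAddCommGroup E2] [InnerProductSpace ℝ E2]
  [NormedAddCommGroup E4] [InnerProductSpace ℝ E4]

/-- The Bianchi map: the 4-linear form associated to an operator
`R : Λ²V → Λ²V` by `b(R)(X,Y,Z,W) = (1/3)(⟪R(X∧Y), Z∧W⟫ + ⟪R(Y∧Z), X∧W⟫ +
⟪R(Z∧X), Y∧W⟫)`. -/
def bianchi (M : ExtModel V E2 E4) (R : E2 →ₗ[ℝ] E2) (X Y Z W : V) : ℝ :=
  (1 / 3) * (⟪R (M.wedge2 X Y), M.wedge2 Z W⟫_ℝ + ⟪R (M.wedge2 Y Z), M.wedge2 X W⟫_ℝ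
    + ⟪R (M.wedge2 Z X), M.wedge2 Y W⟫_ℝ)

end ExtModel

/-- If `f ≥ 0` on a compact set and `g > 0` on the zeros of `f`, then `f + ε g > 0` on the whole
set for all small `ε > 0`. -/
theorem IsCompact.exists_forall_pos_add_mul {X : Type*} [TopologicalSpace X] {K : Set X}
    (hK : IsCompact K) {f g : X → ℝ} (hf : Continuous f) (hg : Continuous g)
    (hf_nonneg : ∀ x ∈ K, 0 ≤ f x) (hg_pos : ∀ x ∈ K, f x = 0 → 0 < g x) :
    ∃ ε₀ : ℝ, 0 < ε₀ ∧ ∀ ε : ℝ, 0 < ε → ε < ε₀ → ∀ x ∈ K, 0 < f x + ε * g x := by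
  have hC : IsCompact (K ∩ {x | g x ≤ 0}) := hK.inter_right (isClosed_le hg continuous_const)
  obtain ⟨m, hm, hfm⟩ := hC.exists_forall_le' hf.continuousOn (a := 0) fun x hx =>
    (hf_nonneg x hx.1).lt_of_ne fun h => (hg_pos x hx.1 h.symm).not_ge hx.2
  obtain ⟨M, hM⟩ := hK.exists_bound_of_continuousOn hg.continuousOn
  have hM' : 0 < |M| + 1 := by positivity
  refine ⟨m / (|M| + 1), div_pos hm hM', fun ε hε hε₀ x hx => ?_⟩
  rcases le_or_gt (g x) 0 with hgx | hgx
  · have hεM : ε * (|M| + 1) < m := (lt_div_iff₀ hM').1 hε₀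
    have hgM : -(|M| + 1) ≤ g x := by
      linarith [neg_le_of_abs_le (hM x hx), le_abs_self M]
    linarith [hfm x ⟨hx, hgx⟩, mul_le_mul_of_nonneg_left hgM hε.le]
  · linarith [hf_nonneg x hx, mul_pos hε hgx]

/-- A symmetric positive-semidefinite operator kills every vector on which its quadratic form
vanishes. -/
theorem IsPosSemidef.apply_eq_zero {E : Type*} [NormedAddCommGroup E] [InnerProductSpace ℝ E]
    {T : E →ₗ[ℝ] E} (hT : IsPosSemidef T) (hT_symm : T.IsSymmetric) {v : E}
    (hv : ⟪T v, v⟫_ℝ = 0) : T v = 0 := by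
  have hquad (t : ℝ) : 0 ≤ ⟪T (T v), T v⟫_ℝ * (t * t) + 2 * ⟪T v, T v⟫_ℝ * t + 0 := by
    have h := hT (v + t • T v)
    simp only [map_add, map_smul, inner_add_left, inner_add_right, real_inner_smul_left,
      real_inner_smul_right, hv, hT_symm (T v) v] at h
    linarith
  have hdiscrim := discrim_le_zero hquad
  rw [discrim] at hdiscrim
  exact inner_self_eq_zero (𝕜 := ℝ).1 (by nlinarith)

/-- First-order Lemma. Let `U` be a finite-dimensional real
inner product space and `A`, `B` self-adjoint operators on `U`. If `A` is
positive-semidefinite and `B` is positive-definite on `ker A`, then there is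
`ε₀ > 0` such that `A + ε B` is positive-definite for all `0 < ε < ε₀`. -/
theorem first_order_lemma {U : Type*} [NormedAddCommGroup U] [InnerProductSpace ℝ U]
    [FiniteDimensional ℝ U] (A B : U →ₗ[ℝ] U)
    (hA : A.IsSymmetric) (hB : B.IsSymmetric)
    (hA_semidef : IsPosSemidef A)
    (hB_ker : ∀ v ∈ LinearMap.ker A, v ≠ 0 → 0 < ⟪B v, v⟫_ℝ) :
    ∃ ε₀ : ℝ, 0 < ε₀ ∧ ∀ ε : ℝ, 0 < ε → ε < ε₀ → IsPosDef (A + ε • B) := by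
  obtain ⟨ε₀, hε₀, hpos⟩ := (isCompact_sphere (0 : U) 1).exists_forall_pos_add_mul
    (f := fun v => ⟪A v, v⟫_ℝ) (g := fun v => ⟪B v, v⟫_ℝ)
    (A.continuous_of_finiteDimensional.inner continuous_id)
    (B.continuous_of_finiteDimensional.inner continuous_id) (fun v _ => hA_semidef v)
    fun v hv hAv => hB_ker v (hA_semidef.apply_eq_zero hA hAv)
      (ne_zero_of_mem_unit_sphere ⟨v, hv⟩)
  refine ⟨ε₀, hε₀, fun ε hε hεε₀ v hv => ?_⟩
  have h := hpos ε hε hεε₀ (‖v‖⁻¹ • v) (by simp [norm_smul, hv])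
  simp only [map_smul, real_inner_smul_left, real_inner_smul_right] at h
  simp only [LinearMap.add_apply, LinearMap.smul_apply, inner_add_left, real_inner_smul_left]
  refine pos_of_mul_pos_right (a := ‖v‖⁻¹ * ‖v‖⁻¹) ?_ (by positivity)
  linarith
end
end

section
/- Let V̄ be a finite-dimensional real inner product space, V ⊂ V̄ a subspace, and i : Λ²V → Λ²V̄ the induced inclusion. Let R̄ be a self-adjoint operator on Λ²V̄ with strongly positive curvature, and let A : V × V → V^⊥ be a bilinear skew-symmetric map into the orthogonal complement of V. Define α self-adjoint on Λ²V by ⟨α(X∧Y), Z∧W⟩ = ⟨A(X,Y), A(Z,W)⟩, and define the self-adjoint operator R on Λ²V by ⟨R(σ), σ'⟩ = ⟨R̄(i(σ)), i(σ')⟩ + 3⟨α(σ), σ'⟩ − 3⟨b(α)(σ), σ'⟩. Then R has strongly positive curvature; in fact, if R̄ + ω̄ is positive-definite for ω̄ ∈ Λ⁴V̄, then R + (i*ω̄ + 3b(α)) is positive-definite, where i*ω̄ denotes the restriction of ω̄ to V. (This is the algebraic content of the theorem that Riemannian submersions preserve strongly positive curvature.) -/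
/- Common setup: an abstract model of the second and fourth exterior powers
`Λ²V` and `Λ⁴V` of a real inner product space `V`, with the induced inner
products, the identification of 4-vectors with self-adjoint operators on
`Λ²V`, and the Bianchi map. -/

noncomputable section

open scoped InnerProductSpace

namespace ExtModel

variable {V E2 E4 : Type*} [NormedAddCommGroup V] [InnerProductSpace ℝ V]
  [NormedAddCommGroup E2] [InnerProductSpace ℝ E2]
  [NormedAddCommGroup E4] [InnerProductSpace ℝ E4]

/-- Two bilinear forms on `Λ²V` agreeing on pairs of decomposable bivectors are equal. -/
theorem bilin_ext (M : ExtModel V E2 E4) {B C : E2 →ₗ[ℝ] E2 →ₗ[ℝ] ℝ}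
    (h : ∀ X Y Z W : V,
      B (M.wedge2 X Y) (M.wedge2 Z W) = C (M.wedge2 X Y) (M.wedge2 Z W)) : B = C := by
  refine LinearMap.ext_on M.span_wedge2 ?_
  rintro _ ⟨X, Y, rfl⟩
  refine LinearMap.ext_on M.span_wedge2 ?_
  rintro _ ⟨Z, W, rfl⟩
  exact h X Y Z W

/-- An operator on `Λ²V` that on decomposable bivectors is the Gram form of some map `A` is
positive-semidefinite. -/
theorem isPosSemidef_of_gram (M : ExtModel V E2 E4) {U : Type*} [NormedAddCommGroup U]
    [InnerProductSpace ℝ U] (A : V → V → U) (α : E2 →ₗ[ℝ] E2)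
    (hα : ∀ X Y Z W : V, ⟪α (M.wedge2 X Y), M.wedge2 Z W⟫_ℝ = ⟪A X Y, A Z W⟫_ℝ) :
    IsPosSemidef α := by
  let s : Set (E2 × U) := {q | ∃ X Y : V, q = (M.wedge2 X Y, A X Y)}
  have gram : ∀ q ∈ Submodule.span ℝ s, ∀ r ∈ Submodule.span ℝ s,
      ⟪α q.1, r.1⟫_ℝ = ⟪q.2, r.2⟫_ℝ := by
    intro q hq r hr
    induction hq, hr using Submodule.span_induction₂ with
    | mem_mem q r hq hr =>
      obtain ⟨X, Y, rfl⟩ := hq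
      obtain ⟨Z, W, rfl⟩ := hr
      exact hα X Y Z W
    | zero_left => simp
    | zero_right => simp
    | add_left _ _ _ _ _ _ h₁ h₂ => simp [inner_add_left, h₁, h₂]
    | add_right _ _ _ _ _ _ h₁ h₂ => simp [inner_add_right, h₁, h₂]
    | smul_left _ _ _ _ _ h => simp [real_inner_smul_left, h]
    | smul_right _ _ _ _ _ h => simp [real_inner_smul_right, h]
  have surj : (Submodule.span ℝ s).map (LinearMap.fst ℝ E2 U) = ⊤ := by
    rw [← top_le_iff, ← M.span_wedge2, Submodule.span_le]
    rintro _ ⟨X, Y, rfl⟩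
    exact ⟨(M.wedge2 X Y, A X Y), Submodule.subset_span ⟨X, Y, rfl⟩, rfl⟩
  intro v
  obtain ⟨q, hq, rfl⟩ : v ∈ (Submodule.span ℝ s).map (LinearMap.fst ℝ E2 U) :=
    surj ▸ Submodule.mem_top
  exact (gram q hq q hq).symm ▸ real_inner_self_nonneg

section Restriction

variable {p : Submodule ℝ V} {F2 F4 : Type*}
  [NormedAddCommGroup F2] [InnerProductSpace ℝ F2]
  [NormedAddCommGroup F4] [InnerProductSpace ℝ F4]

/-- The inclusion `Λ²p → Λ²V` induced by `p ⊆ V` preserves inner products. -/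
theorem inner_inclusion (Mb : ExtModel V E2 E4) (M : ExtModel p F2 F4) (i : F2 →ₗ[ℝ] E2)
    (hi : ∀ X Y : p, i (M.wedge2 X Y) = Mb.wedge2 (X : V) (Y : V)) (σ τ : F2) :
    ⟪i σ, i τ⟫_ℝ = ⟪σ, τ⟫_ℝ := by
  have h : (innerₗ E2).compl₁₂ i i = innerₗ F2 := M.bilin_ext fun X Y Z W => by
    simp [hi, Mb.inner_wedge2, M.inner_wedge2]
  simpa using LinearMap.congr_fun₂ h σ τ

/-- The operator of a restricted 4-form is the compression of the operator of the 4-form. -/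
theorem inner_toOp_restrict (Mb : ExtModel V E2 E4) (M : ExtModel p F2 F4) (i : F2 →ₗ[ℝ] E2)
    (hi : ∀ X Y : p, i (M.wedge2 X Y) = Mb.wedge2 (X : V) (Y : V)) (ω : E4) (η : F4)
    (hη : ∀ X Y Z W : p, ⟪η, M.wedge4 X Y Z W⟫_ℝ = ⟪ω, Mb.wedge4 (X : V) Y Z W⟫_ℝ)
    (σ τ : F2) : ⟪M.toOp η σ, τ⟫_ℝ = ⟪Mb.toOp ω (i σ), i τ⟫_ℝ := by
  have h : (innerₗ F2) ∘ₗ M.toOp η = (innerₗ E2).compl₁₂ (Mb.toOp ω ∘ₗ i) i :=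
    M.bilin_ext fun X Y Z W => by
      simp [hi, Mb.toOp_spec, M.toOp_spec, hη]
  simpa using LinearMap.congr_fun₂ h σ τ

end Restriction

end ExtModel

/-- Algebraic content of Theorem A: Riemannian submersions
preserve strongly positive curvature. Let `V̄` be a finite-dimensional real
inner product space, `p ⊆ V̄` a subspace, `i : Λ²p → Λ²V̄` the induced
inclusion, `R̄` a self-adjoint operator on `Λ²V̄`, `A : p × p → pᗮ` a bilinear
skew-symmetric map, `α` the self-adjoint operator on `Λ²p` with
`⟪α(X∧Y), Z∧W⟫ = ⟪A(X,Y), A(Z,W)⟫`, `βα ∈ Λ⁴p` the 4-form representing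
`b(α)`, and `R` the self-adjoint operator on `Λ²p` defined by
`⟪R(σ), σ'⟫ = ⟪R̄(i σ), i σ'⟫ + 3⟪α σ, σ'⟫ − 3⟪b(α) σ, σ'⟫`.
If `R̄ + ω̄` is positive-definite for `ω̄ ∈ Λ⁴V̄`, then
`R + (i*ω̄ + 3 b(α))` is positive-definite (where `i*ω̄ = ωres` is the
restriction of `ω̄` to `p`); in particular `R` has strongly positive
curvature. -/
theorem submersions_preserve_strongly_positive_curvature
    {Vb E2b E4b : Type*}
    [NormedAddCommGroup Vb] [InnerProductSpace ℝ Vb] [FiniteDimensional ℝ Vb]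
    [NormedAddCommGroup E2b] [InnerProductSpace ℝ E2b] [FiniteDimensional ℝ E2b]
    [NormedAddCommGroup E4b] [InnerProductSpace ℝ E4b] [FiniteDimensional ℝ E4b]
    (Mb : ExtModel Vb E2b E4b)
    (p : Submodule ℝ Vb)
    {E2 E4 : Type*}
    [NormedAddCommGroup E2] [InnerProductSpace ℝ E2] [FiniteDimensional ℝ E2]
    [NormedAddCommGroup E4] [InnerProductSpace ℝ E4] [FiniteDimensional ℝ E4]
    (M : ExtModel (↥p) E2 E4)
    (i : E2 →ₗ[ℝ] E2b)
    (hi : ∀ X Y : ↥p, i (M.wedge2 X Y) = Mb.wedge2 (X : Vb) (Y : Vb))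
    (Rb : E2b →ₗ[ℝ] E2b) (hRb_sym : Rb.IsSymmetric)
    (A : ↥p →ₗ[ℝ] ↥p →ₗ[ℝ] ↥pᗮ) (hA_skew : ∀ X Y : ↥p, A X Y = - A Y X)
    (α : E2 →ₗ[ℝ] E2)
    (hα : ∀ X Y Z W : ↥p, ⟪α (M.wedge2 X Y), M.wedge2 Z W⟫_ℝ = ⟪A X Y, A Z W⟫_ℝ)
    (βα : E4)
    (hβα : ∀ X Y Z W : ↥p, ⟪βα, M.wedge4 X Y Z W⟫_ℝ = M.bianchi α X Y Z W)
    (R : E2 →ₗ[ℝ] E2)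
    (hR : ∀ σ σ' : E2, ⟪R σ, σ'⟫_ℝ
      = ⟪Rb (i σ), i σ'⟫_ℝ + 3 * ⟪α σ, σ'⟫_ℝ - 3 * ⟪M.toOp βα σ, σ'⟫_ℝ)
    (ωb : E4b) (hωb : IsPosDef (Rb + Mb.toOp ωb))
    (ωres : E4)
    (hωres : ∀ X Y Z W : ↥p, ⟪ωres, M.wedge4 X Y Z W⟫_ℝ
      = ⟪ωb, Mb.wedge4 (X : Vb) (Y : Vb) (Z : Vb) (W : Vb)⟫_ℝ) :
    IsPosDef (R + M.toOp (ωres + (3 : ℝ) • βα)) ∧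
    ∃ ω : E4, IsPosDef (R + M.toOp ω) := by
  have key : IsPosDef (R + M.toOp (ωres + (3 : ℝ) • βα)) := by
    intro σ hσ
    have hiσ : i σ ≠ 0 := by
      intro h
      have hinner := Mb.inner_inclusion M i hi σ σ
      rw [h, inner_zero_left] at hinner
      exact hσ (inner_self_eq_zero.mp hinner.symm)
    have hpos := hωb (i σ) hiσ
    have hα_nonneg := M.isPosSemidef_of_gram (fun X Y => A X Y) α hα σ
    have hres := Mb.inner_toOp_restrict M i hi ωb ωres hωres σ σ
    simp only [LinearMap.add_apply, inner_add_left] at hpos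
    simp only [map_add, map_smul, LinearMap.add_apply, LinearMap.smul_apply, inner_add_left,
      real_inner_smul_left, hR, hres]
    linarith
  exact ⟨key, _, key⟩
end
end

section
/- Let V̄ be a finite-dimensional real inner product space and V ⊂ V̄ a subspace. If a self-adjoint operator R̄ on Λ²V̄ has strongly positive curvature, then the restricted operator R on Λ²V, defined by ⟨R(X∧Y), Z∧W⟩ = ⟨R̄(X∧Y), Z∧W⟩ for X, Y, Z, W ∈ V, also has strongly positive curvature. (This is the algebraic content of the proposition that totally geodesic submanifolds inherit strongly positive curvature.) -/
/- Common setup: an abstract model of the second and fourth exterior powers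
`Λ²V` and `Λ⁴V` of a real inner product space `V`, with the induced inner
products, the identification of 4-vectors with self-adjoint operators on
`Λ²V`, and the Bianchi map. -/

noncomputable section

open scoped InnerProductSpace

/-- If the vectors `a i` span `E` and have the same Gram matrix as the vectors `b i` of `F`, then
`a i ↦ b i` extends to an isometric linear map `E → F`. -/
theorem exists_linearIsometry_of_inner_eq {ι E F : Type*}
    [NormedAddCommGroup E] [InnerProductSpace ℝ E]
    [NormedAddCommGroup F] [InnerProductSpace ℝ F] (a : ι → E) (b : ι → F)
    (hspan : Submodule.span ℝ (Set.range a) = ⊤)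
    (hab : ∀ i j, ⟪a i, a j⟫_ℝ = ⟪b i, b j⟫_ℝ) :
    ∃ L : E →ₗᵢ[ℝ] F, ∀ i, L (a i) = b i := by
  have hnorm (f : ι →₀ ℝ) :
      ‖Finsupp.linearCombination ℝ a f‖ = ‖Finsupp.linearCombination ℝ b f‖ := by
    simp only [@norm_eq_sqrt_real_inner, Finsupp.linearCombination_apply, Finsupp.sum,
      sum_inner, inner_sum, real_inner_smul_left, real_inner_smul_right, hab]
  have hsurj : LinearMap.range (Finsupp.linearCombination ℝ a) = ⊤ := by
    rw [Finsupp.range_linearCombination, hspan]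
  obtain ⟨g, hg⟩ := (Finsupp.linearCombination ℝ a).exists_rightInverse_of_surjective hsurj
  have hg' (v : E) : Finsupp.linearCombination ℝ a (g v) = v := LinearMap.congr_fun hg v
  refine ⟨⟨Finsupp.linearCombination ℝ b ∘ₗ g, fun v => ?_⟩, fun i => ?_⟩
  · rw [LinearMap.comp_apply, ← hnorm, hg']
  · change Finsupp.linearCombination ℝ b (g (a i)) = b i
    have h := hnorm (g (a i) - Finsupp.single i 1)
    rw [map_sub, map_sub, hg', Finsupp.linearCombination_single,
      Finsupp.linearCombination_single, one_smul, one_smul, sub_self, norm_zero] at h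
    exact sub_eq_zero.mp (norm_eq_zero.mp h.symm)

/-- Linear operators whose matrix coefficients on a spanning set agree are equal. -/
theorem LinearMap.ext_inner_of_span_eq_top {E : Type*}
    [NormedAddCommGroup E] [InnerProductSpace ℝ E] {s : Set E}
    (hs : Submodule.span ℝ s = ⊤) {S T : E →ₗ[ℝ] E}
    (h : ∀ v ∈ s, ∀ w ∈ s, ⟪S v, w⟫_ℝ = ⟪T v, w⟫_ℝ) : S = T := by
  refine LinearMap.ext_on hs fun v hv => ext_inner_right ℝ fun w => ?_
  exact LinearMap.congr_fun
    (LinearMap.ext_on hs fun w hw => h v hv w hw : innerₛₗ ℝ (S v) = innerₛₗ ℝ (T v)) w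

namespace ExtModel

variable {V E2 E4 V' E2' E4' : Type*}
  [NormedAddCommGroup V] [InnerProductSpace ℝ V]
  [NormedAddCommGroup E2] [InnerProductSpace ℝ E2]
  [NormedAddCommGroup E4] [InnerProductSpace ℝ E4]
  [NormedAddCommGroup V'] [InnerProductSpace ℝ V']
  [NormedAddCommGroup E2'] [InnerProductSpace ℝ E2']
  [NormedAddCommGroup E4'] [InnerProductSpace ℝ E4']

/-- An isometry `V → V'` induces an isometry `Λ²V → Λ²V'`. -/
theorem exists_linearIsometry_wedge2 (M : ExtModel V E2 E4) (M' : ExtModel V' E2' E4')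
    (f : V →ₗᵢ[ℝ] V') :
    ∃ L : E2 →ₗᵢ[ℝ] E2', ∀ X Y, L (M.wedge2 X Y) = M'.wedge2 (f X) (f Y) := by
  obtain ⟨L, hL⟩ := exists_linearIsometry_of_inner_eq
    (fun x : V × V => M.wedge2 x.1 x.2) (fun x => M'.wedge2 (f x.1) (f x.2))
    (by
      rw [← M.span_wedge2]
      congr 1
      ext σ
      simp [eq_comm])
    (fun x y => by simp only [inner_wedge2, LinearIsometry.inner_map_map])
  exact ⟨L, fun X Y => hL (X, Y)⟩

/-- An isometry `V → V'` induces an isometry `Λ⁴V → Λ⁴V'`. -/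
theorem exists_linearIsometry_wedge4 (M : ExtModel V E2 E4) (M' : ExtModel V' E2' E4')
    (f : V →ₗᵢ[ℝ] V') :
    ∃ L : E4 →ₗᵢ[ℝ] E4', ∀ X Y Z W,
      L (M.wedge4 X Y Z W) = M'.wedge4 (f X) (f Y) (f Z) (f W) := by
  obtain ⟨L, hL⟩ := exists_linearIsometry_of_inner_eq
    (fun x : Fin 4 → V => M.wedge4 (x 0) (x 1) (x 2) (x 3))
    (fun x => M'.wedge4 (f (x 0)) (f (x 1)) (f (x 2)) (f (x 3)))
    (by
      rw [← M.span_wedge4]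
      congr 1
      ext σ
      constructor
      · rintro ⟨x, rfl⟩
        exact ⟨x 0, x 1, x 2, x 3, rfl⟩
      · rintro ⟨X, Y, Z, W, rfl⟩
        exact ⟨![X, Y, Z, W], rfl⟩)
    (fun x y => by
      have h := M'.inner_wedge4 (fun i => f (x i)) (fun i => f (y i))
      simp only [LinearIsometry.inner_map_map] at h
      rw [M.inner_wedge4, h])
  exact ⟨L, fun X Y Z W => hL ![X, Y, Z, W]⟩

end ExtModel

/-- Algebraic content of Proposition: totally geodesic
submanifolds inherit strongly positive curvature. Let `V̄` be a
finite-dimensional real inner product space and `p ⊆ V̄` a subspace. If a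
self-adjoint operator `R̄` on `Λ²V̄` has strongly positive curvature, then the
restricted operator `R` on `Λ²p`, defined by
`⟪R (X∧Y), Z∧W⟫ = ⟪R̄ (X∧Y), Z∧W⟫` for `X, Y, Z, W ∈ p`, also has strongly
positive curvature. -/
theorem restriction_strongly_positive_curvature
    {Vb E2b E4b : Type*}
    [NormedAddCommGroup Vb] [InnerProductSpace ℝ Vb] [FiniteDimensional ℝ Vb]
    [NormedAddCommGroup E2b] [InnerProductSpace ℝ E2b] [FiniteDimensional ℝ E2b]
    [NormedAddCommGroup E4b] [InnerProductSpace ℝ E4b] [FiniteDimensional ℝ E4b]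
    (Mb : ExtModel Vb E2b E4b)
    (p : Submodule ℝ Vb)
    {E2 E4 : Type*}
    [NormedAddCommGroup E2] [InnerProductSpace ℝ E2] [FiniteDimensional ℝ E2]
    [NormedAddCommGroup E4] [InnerProductSpace ℝ E4] [FiniteDimensional ℝ E4]
    (M : ExtModel (↥p) E2 E4)
    (Rb : E2b →ₗ[ℝ] E2b) (hRb_sym : Rb.IsSymmetric)
    (hRb : ∃ ωb : E4b, IsPosDef (Rb + Mb.toOp ωb))
    (R : E2 →ₗ[ℝ] E2)
    (hR : ∀ X Y Z W : ↥p, ⟪R (M.wedge2 X Y), M.wedge2 Z W⟫_ℝ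
      = ⟪Rb (Mb.wedge2 (X : Vb) (Y : Vb)), Mb.wedge2 (Z : Vb) (W : Vb)⟫_ℝ) :
    ∃ ω : E4, IsPosDef (R + M.toOp ω) := by
  obtain ⟨ωb, hpos⟩ := hRb
  obtain ⟨L2, hL2⟩ := M.exists_linearIsometry_wedge2 Mb p.subtypeₗᵢ
  obtain ⟨L4, hL4⟩ := M.exists_linearIsometry_wedge4 Mb p.subtypeₗᵢ
  refine ⟨LinearMap.adjoint L4.toLinearMap ωb, fun v hv => ?_⟩
  have key : R + M.toOp (LinearMap.adjoint L4.toLinearMap ωb) =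
      LinearMap.adjoint L2.toLinearMap ∘ₗ (Rb + Mb.toOp ωb) ∘ₗ L2.toLinearMap := by
    refine LinearMap.ext_inner_of_span_eq_top M.span_wedge2 ?_
    rintro _ ⟨X, Y, rfl⟩ _ ⟨Z, W, rfl⟩
    simp [LinearMap.adjoint_inner_left, inner_add_left, hR, hL2, hL4, ExtModel.toOp_spec]
  rw [key, LinearMap.comp_apply, LinearMap.adjoint_inner_left]
  exact hpos _ fun h => hv (L2.injective (h.trans L2.map_zero.symm))
end
end

section
/- If dim V ≤ 4 and R is an algebraic curvature operator on Λ²V, then R has strongly positive curvature if and only if sec_R(σ) > 0 for every nonzero decomposable σ ∈ Λ²V. -/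
/- Common setup: an abstract model of the second and fourth exterior powers
`Λ²V` and `Λ⁴V` of a real inner product space `V`, with the induced inner
products, the identification of 4-vectors with self-adjoint operators on
`Λ²V`, and the Bianchi map. -/

noncomputable section

open scoped InnerProductSpace

/-- If the quadratic form of `A` is nonnegative on the zero set of the quadratic form of `B`, then
`A` and `B` satisfy a cross inequality on vectors where `B` takes opposite signs. -/
theorem inner_mul_sub_inner_mul_nonneg {E : Type*} [NormedAddCommGroup E] [InnerProductSpace ℝ E]
    {A B : E →ₗ[ℝ] E} (h : ∀ v : E, ⟪B v, v⟫_ℝ = 0 → 0 ≤ ⟪A v, v⟫_ℝ) {x y : E}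
    (hx : ⟪B x, x⟫_ℝ < 0) (hy : 0 < ⟪B y, y⟫_ℝ) :
    0 ≤ ⟪A x, x⟫_ℝ * ⟪B y, y⟫_ℝ - ⟪A y, y⟫_ℝ * ⟪B x, x⟫_ℝ := by
  have expand (T : E →ₗ[ℝ] E) (s : ℝ) : ⟪T (y + s • x), y + s • x⟫_ℝ
      = ⟪T y, y⟫_ℝ + s * (⟪T y, x⟫_ℝ + ⟪T x, y⟫_ℝ) + s ^ 2 * ⟪T x, x⟫_ℝ := by
    simp only [map_add, map_smul, inner_add_left, inner_add_right, real_inner_smul_left,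
      real_inner_smul_right]
    ring
  set p := ⟪B x, x⟫_ℝ
  set q := ⟪B y, y⟫_ℝ
  set b := ⟪B y, x⟫_ℝ + ⟪B x, y⟫_ℝ
  set c := ⟪A y, x⟫_ℝ + ⟪A x, y⟫_ℝ
  set r := √(b ^ 2 - 4 * p * q)
  have hr2 : r ^ 2 = b ^ 2 - 4 * p * q := Real.sq_sqrt (by nlinarith [sq_nonneg b])
  have hbr : |b| < r := by
    rw [← Real.sqrt_sq_eq_abs]
    exact Real.sqrt_lt_sqrt (sq_nonneg b) (by nlinarith)
  obtain ⟨hbr1, hbr2⟩ := abs_lt.mp hbr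
  have root (ρ : ℝ) (hρ : ρ ^ 2 = b ^ 2 - 4 * p * q) :
      0 ≤ 4 * p ^ 2 * ⟪A y, y⟫_ℝ + 2 * p * (-b + ρ) * c + (-b + ρ) ^ 2 * ⟪A x, x⟫_ℝ := by
    have hp : p ≠ 0 := hx.ne
    have h0 : ⟪B (y + ((-b + ρ) / (2 * p)) • x), y + ((-b + ρ) / (2 * p)) • x⟫_ℝ = 0 := by
      rw [expand B]
      change q + (-b + ρ) / (2 * p) * b + ((-b + ρ) / (2 * p)) ^ 2 * p = 0
      field_simp
      linear_combination hρ
    have h1 := h _ h0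
    rw [expand A] at h1
    have h2 := mul_nonneg (by positivity : 0 ≤ 4 * p ^ 2) h1
    refine h2.trans_eq ?_
    change 4 * p ^ 2 * (_ + (-b + ρ) / (2 * p) * c + _) = _
    field_simp
    ring
  have h1 := mul_nonneg (root r hr2) (by linarith : 0 ≤ b + r)
  have h2 := mul_nonneg (root (-r) (by rw [neg_sq, hr2])) (by linarith : 0 ≤ r - b)
  have hr : 0 < r := (abs_nonneg b).trans_lt hbr
  have h3 : 0 ≤ (8 * r * -p) * (⟪A x, x⟫_ℝ * q - ⟪A y, y⟫_ℝ * p) := by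
    refine (add_nonneg h1 h2).trans_eq ?_
    linear_combination 2 * r * ⟪A x, x⟫_ℝ * hr2
  exact nonneg_of_mul_nonneg_right h3 (by nlinarith)

/-- If `f` is positive on the zeros of `g ≥ 0` in a compact set, then `f + M g` is positive on
this set for some `M`. -/
theorem IsCompact.exists_forall_add_mul_pos {E : Type*} [TopologicalSpace E] {K : Set E}
    (hK : IsCompact K) {f g : E → ℝ} (hf : Continuous f) (hg : Continuous g)
    (hg0 : ∀ v, 0 ≤ g v) (h : ∀ v ∈ K, g v = 0 → 0 < f v) :
    ∃ M : ℝ, 0 ≤ M ∧ ∀ v ∈ K, 0 < f v + M * g v := by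
  obtain ⟨n, hn⟩ := hK.elim_directed_cover (fun n : ℕ => {v | 0 < f v + n * g v})
    (fun n => isOpen_lt continuous_const (by fun_prop)) (fun v hv => by
      rw [Set.mem_iUnion]
      rcases (hg0 v).eq_or_lt with h0 | h0
      · exact ⟨0, by simpa using h v hv h0.symm⟩
      · obtain ⟨n, hn⟩ := exists_nat_gt (-f v / g v)
        rw [div_lt_iff₀ h0] at hn
        exact ⟨n, by simp only [Set.mem_ofPred_eq]; linarith⟩)
    (Monotone.directed_le fun m n hmn v (hv : 0 < f v + m * g v) => by
      have : (m : ℝ) * g v ≤ n * g v := by gcongr; exact hg0 v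
      simp only [Set.mem_ofPred_eq]
      linarith)
  exact ⟨n, n.cast_nonneg, fun v hv => hn hv⟩

/-- Finsler's lemma. If the quadratic form of `A` is positive on the nonzero zeros of the
quadratic form of `B`, then `A + t B` is positive-definite for some `t`. -/
theorem exists_isPosDef_add_smul {E : Type*} [NormedAddCommGroup E] [InnerProductSpace ℝ E]
    [FiniteDimensional ℝ E] {A B : E →ₗ[ℝ] E}
    (h : ∀ v : E, v ≠ 0 → ⟪B v, v⟫_ℝ = 0 → 0 < ⟪A v, v⟫_ℝ) :
    ∃ t : ℝ, IsPosDef (A + t • B) := by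
  rcases subsingleton_or_nontrivial E with hE | hE
  · exact ⟨0, fun v hv => absurd (Subsingleton.elim v 0) hv⟩
  have hA : Continuous A := A.continuous_of_finiteDimensional
  have hB : Continuous B := B.continuous_of_finiteDimensional
  have hK : IsCompact (Metric.sphere (0 : E) 1) := isCompact_sphere 0 1
  obtain ⟨M, hM0, hM⟩ := hK.exists_forall_add_mul_pos (f := fun v => ⟪A v, v⟫_ℝ)
    (g := fun v => ⟪B v, v⟫_ℝ ^ 2) (by fun_prop) (by fun_prop) (fun v => sq_nonneg _)
    (fun v hv h0 => h v (ne_zero_of_mem_unit_sphere ⟨v, hv⟩) (by simpa using h0))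
  obtain ⟨v₀, hv₀, hmin⟩ := hK.exists_isMinOn (NormedSpace.sphere_nonempty.mpr zero_le_one)
    (f := fun v => ⟪A v, v⟫_ℝ + M * ⟪B v, v⟫_ℝ ^ 2) (by fun_prop)
  set ε := ⟪A v₀, v₀⟫_ℝ + M * ⟪B v₀, v₀⟫_ℝ ^ 2
  have hε : 0 < ε := hM v₀ hv₀
  have hminε (v : E) (hv : v ∈ Metric.sphere (0 : E) 1) :
      ε ≤ ⟪A v, v⟫_ℝ + M * ⟪B v, v⟫_ℝ ^ 2 := hmin hv
  obtain ⟨C, hC⟩ := hK.exists_bound_of_continuousOn (f := fun v => ⟪B v, v⟫_ℝ) (by fun_prop)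
  simp only [Real.norm_eq_abs, abs_le] at hC
  have hC0 : 0 ≤ C := by linarith [hC v₀ hv₀]
  set A' : E →ₗ[ℝ] E := A - ε • LinearMap.id
  have hA' (v : E) : ⟪A' v, v⟫_ℝ = ⟪A v, v⟫_ℝ - ε * ‖v‖ ^ 2 := by
    simp [A', inner_sub_left, real_inner_smul_left]
  have smul_form (T : E →ₗ[ℝ] E) (c : ℝ) (v : E) :
      ⟪T (c • v), c • v⟫_ℝ = c ^ 2 * ⟪T v, v⟫_ℝ := by
    rw [map_smul, real_inner_smul_left, real_inner_smul_right]
    ring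
  have normalize {v : E} (hv : v ≠ 0) : ‖v‖⁻¹ • v ∈ Metric.sphere (0 : E) 1 := by
    rw [mem_sphere_zero_iff_norm, norm_smul, norm_inv, norm_norm,
      inv_mul_cancel₀ (norm_ne_zero_iff.mpr hv)]
  have hsphere (v : E) (hv : v ∈ Metric.sphere (0 : E) 1) :
      0 ≤ ⟪A' v, v⟫_ℝ + M * ⟪B v, v⟫_ℝ ^ 2 := by
    have := hminε v hv
    rw [hA', mem_sphere_zero_iff_norm.mp hv]
    linarith
  have hzero (v : E) (hv : ⟪B v, v⟫_ℝ = 0) : 0 ≤ ⟪A' v, v⟫_ℝ := by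
    rcases eq_or_ne v 0 with rfl | hv0
    · simp
    have h1 := hsphere _ (normalize hv0)
    rw [smul_form, smul_form, hv] at h1
    have : 0 < (‖v‖⁻¹) ^ 2 := by positivity
    exact nonneg_of_mul_nonneg_right (by simpa using h1) this
  set S : Set ℝ := insert (-(M * C))
    ((fun v => -⟪A' v, v⟫_ℝ / ⟪B v, v⟫_ℝ) '' {v | ‖v‖ = 1 ∧ 0 < ⟪B v, v⟫_ℝ})
  set T : Set ℝ := insert (M * C)
    ((fun v => -⟪A' v, v⟫_ℝ / ⟪B v, v⟫_ℝ) '' {v | ‖v‖ = 1 ∧ ⟪B v, v⟫_ℝ < 0})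
  obtain ⟨t, hSt, htT⟩ : ∃ t, (∀ s ∈ S, s ≤ t) ∧ ∀ s ∈ T, t ≤ s := by
    have hST : ∀ s ∈ S, ∀ r ∈ T, s ≤ r := by
      have hMC : 0 ≤ M * C := mul_nonneg hM0 hC0
      rintro s (rfl | ⟨y, ⟨hy, hBy⟩, rfl⟩) r (rfl | ⟨x, ⟨hx, hBx⟩, rfl⟩)
      · linarith
      · have hx' := mem_sphere_zero_iff_norm.mpr hx
        have h1 := hsphere x hx'
        have h2 := (hC x hx').1
        rw [le_div_iff_of_neg hBx]
        nlinarith [mul_nonneg hM0 (mul_nonneg (neg_nonneg.mpr hBx.le)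
          (by linarith : 0 ≤ C + ⟪B x, x⟫_ℝ))]
      · have hy' := mem_sphere_zero_iff_norm.mpr hy
        have h1 := hsphere y hy'
        have h2 := (hC y hy').2
        rw [div_le_iff₀ hBy]
        nlinarith [mul_nonneg hM0 (mul_nonneg hBy.le
          (by linarith : 0 ≤ C - ⟪B y, y⟫_ℝ))]
      · have h1 := inner_mul_sub_inner_mul_nonneg hzero hBx hBy
        change _ / _ ≤ _ / _
        rw [div_le_iff₀ hBy, div_mul_eq_mul_div, le_div_iff_of_neg hBx]
        linarith
    exact ⟨sSup S, fun s hs => le_csSup ⟨M * C, fun s hs => hST s hs _ (Set.mem_insert _ _)⟩ hs,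
      fun r hr => csSup_le (Set.insert_nonempty _ _) fun s hs => hST s hs r hr⟩
  refine ⟨t, fun v hv => ?_⟩
  have hu : ‖‖v‖⁻¹ • v‖ = 1 := mem_sphere_zero_iff_norm.mp (normalize hv)
  set u := ‖v‖⁻¹ • v
  have key : 0 ≤ ⟪A' u, u⟫_ℝ + t * ⟪B u, u⟫_ℝ := by
    rcases lt_trichotomy ⟪B u, u⟫_ℝ 0 with h0 | h0 | h0
    · have := htT _ (Set.mem_insert_of_mem _ ⟨u, ⟨hu, h0⟩, rfl⟩)
      rw [le_div_iff_of_neg h0] at this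
      linarith
    · rw [h0, mul_zero, add_zero]
      exact hzero u h0
    · have := hSt _ (Set.mem_insert_of_mem _ ⟨u, ⟨hu, h0⟩, rfl⟩)
      rw [div_le_iff₀ h0] at this
      linarith
  have hvu : v = ‖v‖ • u := by
    rw [smul_smul, mul_inv_cancel₀ (norm_ne_zero_iff.mpr hv), one_smul]
  have hn : 0 < ‖v‖ ^ 2 := by positivity
  rw [hvu, smul_form]
  refine mul_pos hn ?_
  rw [hA', hu] at key
  rw [LinearMap.add_apply, LinearMap.smul_apply, inner_add_left, real_inner_smul_left]
  linarith

namespace ExtModel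

variable {V E2 E4 : Type*} [NormedAddCommGroup V] [InnerProductSpace ℝ V]
  [NormedAddCommGroup E2] [InnerProductSpace ℝ E2]
  [NormedAddCommGroup E4] [InnerProductSpace ℝ E4] (M : ExtModel V E2 E4)

theorem wedge2_swap (X Y : V) : M.wedge2 Y X = -M.wedge2 X Y := by
  have h := M.wedge2_self (X + Y)
  simp only [map_add, LinearMap.add_apply, M.wedge2_self, zero_add, add_zero] at h
  exact eq_neg_of_add_eq_zero_left h

theorem wedge4_swap₁₂ (X Y Z W : V) : M.wedge4 Y X Z W = -M.wedge4 X Y Z W := by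
  have h := M.wedge4_self₁₂ (X + Y) Z W
  simp only [map_add, LinearMap.add_apply, M.wedge4_self₁₂, zero_add, add_zero] at h
  exact eq_neg_of_add_eq_zero_left h

theorem wedge4_swap₂₃ (X Y Z W : V) : M.wedge4 X Z Y W = -M.wedge4 X Y Z W := by
  have h := M.wedge4_self₂₃ X (Y + Z) W
  simp only [map_add, LinearMap.add_apply, M.wedge4_self₂₃, zero_add, add_zero] at h
  exact eq_neg_of_add_eq_zero_left h

theorem wedge4_swap₃₄ (X Y Z W : V) : M.wedge4 X Y W Z = -M.wedge4 X Y Z W := by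
  have h := M.wedge4_self₃₄ X Y (Z + W)
  simp only [map_add, M.wedge4_self₃₄, LinearMap.add_apply, zero_add, add_zero] at h
  exact eq_neg_of_add_eq_zero_left h

theorem wedge4_self₁₃ (X Y W : V) : M.wedge4 X Y X W = 0 := by
  rw [M.wedge4_swap₂₃, M.wedge4_self₁₂, neg_zero]

theorem wedge4_self₂₄ (X Y Z : V) : M.wedge4 X Y Z Y = 0 := by
  rw [M.wedge4_swap₃₄, M.wedge4_self₂₃, neg_zero]

theorem wedge4_self₁₄ (X Y Z : V) : M.wedge4 X Y Z X = 0 := by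
  rw [M.wedge4_swap₃₄, M.wedge4_self₁₃, neg_zero]

theorem inner_toOp_wedge2_self (ω : E4) (X Y : V) :
    ⟪M.toOp ω (M.wedge2 X Y), M.wedge2 X Y⟫_ℝ = 0 := by
  rw [M.toOp_spec, M.wedge4_self₁₃, inner_zero_right]

/-- The bivector with the given Plücker coordinates with respect to four vectors. -/
def bivector (e₀ e₁ e₂ e₃ : V) (a₀₁ a₀₂ a₀₃ a₁₂ a₁₃ a₂₃ : ℝ) : E2 :=
  a₀₁ • M.wedge2 e₀ e₁ + a₀₂ • M.wedge2 e₀ e₂ + a₀₃ • M.wedge2 e₀ e₃ + a₁₂ • M.wedge2 e₁ e₂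
    + a₁₃ • M.wedge2 e₁ e₃ + a₂₃ • M.wedge2 e₂ e₃

theorem exists_eq_bivector {e₀ e₁ e₂ e₃ : V}
    (he : ∀ X : V, ∃ x₀ x₁ x₂ x₃ : ℝ, X = x₀ • e₀ + x₁ • e₁ + x₂ • e₂ + x₃ • e₃) (σ : E2) :
    ∃ a b c d f g : ℝ, σ = M.bivector e₀ e₁ e₂ e₃ a b c d f g := by
  have hσ : σ ∈ Submodule.span ℝ {σ : E2 | ∃ X Y : V, σ = M.wedge2 X Y} := by
    rw [M.span_wedge2]
    exact Submodule.mem_top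
  unfold bivector
  induction hσ using Submodule.span_induction with
  | mem σ h =>
    obtain ⟨X, Y, rfl⟩ := h
    obtain ⟨x₀, x₁, x₂, x₃, rfl⟩ := he X
    obtain ⟨y₀, y₁, y₂, y₃, rfl⟩ := he Y
    refine ⟨x₀ * y₁ - x₁ * y₀, x₀ * y₂ - x₂ * y₀, x₀ * y₃ - x₃ * y₀, x₁ * y₂ - x₂ * y₁,
      x₁ * y₃ - x₃ * y₁, x₂ * y₃ - x₃ * y₂, ?_⟩
    simp only [map_add, map_smul, LinearMap.add_apply, LinearMap.smul_apply, M.wedge2_self]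
    rw [M.wedge2_swap e₀ e₁, M.wedge2_swap e₀ e₂, M.wedge2_swap e₀ e₃, M.wedge2_swap e₁ e₂,
      M.wedge2_swap e₁ e₃, M.wedge2_swap e₂ e₃]
    module
  | zero => exact ⟨0, 0, 0, 0, 0, 0, by simp⟩
  | add σ τ _ _ hσ hτ =>
    obtain ⟨a, b, c, d, f, g, rfl⟩ := hσ
    obtain ⟨a', b', c', d', f', g', rfl⟩ := hτ
    exact ⟨a + a', b + b', c + c', d + d', f + f', g + g', by module⟩
  | smul r σ _ hσ =>
    obtain ⟨a, b, c, d, f, g, rfl⟩ := hσ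
    exact ⟨r * a, r * b, r * c, r * d, r * f, r * g, by module⟩

theorem exists_bivector_eq_wedge2_of_ne_zero (e₀ e₁ e₂ e₃ : V) {a b c d f g : ℝ} (ha : a ≠ 0)
    (h : a * g - b * f + c * d = 0) :
    ∃ X Y : V, M.bivector e₀ e₁ e₂ e₃ a b c d f g = M.wedge2 X Y := by
  refine ⟨e₀ - (d / a) • e₂ - (f / a) • e₃, a • e₁ + b • e₂ + c • e₃, ?_⟩
  have hg : g = (b * f - c * d) / a := by
    field_simp
    linear_combination h
  simp only [bivector, map_add, map_sub, map_smul, LinearMap.sub_apply, LinearMap.smul_apply,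
    M.wedge2_self]
  rw [M.wedge2_swap e₁ e₂, M.wedge2_swap e₁ e₃, M.wedge2_swap e₂ e₃, hg]
  match_scalars <;> field_simp
  ring

/-- A bivector whose coordinates satisfy the Plücker relation is decomposable. -/
theorem exists_bivector_eq_wedge2 (e₀ e₁ e₂ e₃ : V) {a b c d f g : ℝ}
    (h : a * g - b * f + c * d = 0) :
    ∃ X Y : V, M.bivector e₀ e₁ e₂ e₃ a b c d f g = M.wedge2 X Y := by
  have permute {e₀' e₁' e₂' e₃' : V} {a' b' c' d' f' g' : ℝ} (ha' : a' ≠ 0)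
      (h' : a' * g' - b' * f' + c' * d' = a * g - b * f + c * d)
      (hσ : M.bivector e₀ e₁ e₂ e₃ a b c d f g = M.bivector e₀' e₁' e₂' e₃' a' b' c' d' f' g') :
      ∃ X Y : V, M.bivector e₀ e₁ e₂ e₃ a b c d f g = M.wedge2 X Y := by
    rw [hσ]
    exact M.exists_bivector_eq_wedge2_of_ne_zero _ _ _ _ ha' (h'.trans h)
  have s₁ := M.wedge2_swap e₀ e₁
  have s₂ := M.wedge2_swap e₀ e₂
  have s₃ := M.wedge2_swap e₀ e₃
  have s₄ := M.wedge2_swap e₁ e₂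
  have s₅ := M.wedge2_swap e₁ e₃
  have s₆ := M.wedge2_swap e₂ e₃
  by_cases ha : a ≠ 0
  · exact M.exists_bivector_eq_wedge2_of_ne_zero e₀ e₁ e₂ e₃ ha h
  by_cases hb : b ≠ 0
  · refine permute (e₀' := e₀) (e₁' := e₂) (e₂' := e₃) (e₃' := e₁) (b' := c) (c' := a) (d' := g)
      (f' := -d) (g' := -f) hb (by ring) ?_
    simp only [bivector, s₄, s₅]
    module
  by_cases hc : c ≠ 0
  · refine permute (e₀' := e₀) (e₁' := e₃) (e₂' := e₁) (e₃' := e₂) (b' := a) (c' := b) (d' := -f)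
      (f' := -g) (g' := d) hc (by ring) ?_
    simp only [bivector, s₅, s₆]
    module
  by_cases hd : d ≠ 0
  · refine permute (e₀' := e₁) (e₁' := e₂) (e₂' := e₀) (e₃' := e₃) (b' := -a) (c' := f) (d' := -b)
      (f' := g) (g' := c) hd (by ring) ?_
    simp only [bivector, s₁, s₂]
    module
  by_cases hf : f ≠ 0
  · refine permute (e₀' := e₁) (e₁' := e₃) (e₂' := e₂) (e₃' := e₀) (b' := d) (c' := -a) (d' := -g)
      (f' := -c) (g' := -b) hf (by ring) ?_
    simp only [bivector, s₁, s₂, s₃, s₆]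
    module
  by_cases hg : g ≠ 0
  · refine permute (e₀' := e₂) (e₁' := e₃) (e₂' := e₀) (e₃' := e₁) (b' := -b) (c' := -d) (d' := -c)
      (f' := -f) (g' := a) hg (by ring) ?_
    simp only [bivector, s₂, s₃, s₄, s₅]
    module
  push Not at ha hb hc hd hf hg
  exact ⟨0, 0, by simp [bivector, ha, hb, hc, hd, hf, hg]⟩

theorem inner_toOp_bivector (e₀ e₁ e₂ e₃ : V) (ω : E4) (a b c d f g : ℝ) :
    ⟪M.toOp ω (M.bivector e₀ e₁ e₂ e₃ a b c d f g), M.bivector e₀ e₁ e₂ e₃ a b c d f g⟫_ℝ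
      = 2 * (a * g - b * f + c * d) * ⟪ω, M.wedge4 e₀ e₁ e₂ e₃⟫_ℝ := by
  have h₁ : M.wedge4 e₀ e₂ e₁ e₃ = -M.wedge4 e₀ e₁ e₂ e₃ := M.wedge4_swap₂₃ ..
  have h₂ : M.wedge4 e₀ e₃ e₁ e₂ = M.wedge4 e₀ e₁ e₂ e₃ := by
    rw [M.wedge4_swap₂₃, M.wedge4_swap₃₄, neg_neg]
  have h₃ : M.wedge4 e₁ e₂ e₀ e₃ = M.wedge4 e₀ e₁ e₂ e₃ := by
    rw [M.wedge4_swap₂₃, M.wedge4_swap₁₂, neg_neg]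
  have h₄ : M.wedge4 e₁ e₃ e₀ e₂ = -M.wedge4 e₀ e₁ e₂ e₃ := by
    rw [M.wedge4_swap₂₃, M.wedge4_swap₁₂, M.wedge4_swap₃₄, neg_neg]
  have h₅ : M.wedge4 e₂ e₃ e₀ e₁ = M.wedge4 e₀ e₁ e₂ e₃ := by
    rw [M.wedge4_swap₂₃, M.wedge4_swap₁₂, M.wedge4_swap₃₄, M.wedge4_swap₂₃, neg_neg, neg_neg]
  simp only [bivector, map_add, map_smul, inner_add_left, inner_add_right, real_inner_smul_left,
    real_inner_smul_right, M.toOp_spec, M.wedge4_self₁₃, M.wedge4_self₁₄,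
    M.wedge4_self₂₃, M.wedge4_self₂₄, h₁, h₂, h₃, h₄, h₅, inner_zero_right,
    inner_neg_right]
  ring

end ExtModel

/-- A real inner product space of dimension at most `4` is spanned by four vectors, the last of
which vanishes unless they are orthonormal. -/
theorem exists_four_spanning {V : Type*} [NormedAddCommGroup V] [InnerProductSpace ℝ V]
    [FiniteDimensional ℝ V] (hdim : Module.finrank ℝ V ≤ 4) :
    ∃ e : Fin 4 → V,
      (∀ X : V, ∃ x₀ x₁ x₂ x₃ : ℝ, X = x₀ • e 0 + x₁ • e 1 + x₂ • e 2 + x₃ • e 3)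
        ∧ (e 3 = 0 ∨ Orthonormal ℝ e) := by
  have b := stdOrthonormalBasis ℝ V
  generalize Module.finrank ℝ V = n at hdim b
  rcases hdim.eq_or_lt with rfl | hn
  · refine ⟨b, fun X => ⟨b.repr X 0, b.repr X 1, b.repr X 2, b.repr X 3, ?_⟩, .inr b.orthonormal⟩
    rw [← Fin.sum_univ_four fun i => b.repr X i • b i, b.sum_repr]
  · refine ⟨fun i => if h : i.val < n then b ⟨i, h⟩ else 0, fun X => ?_, .inl ?_⟩
    · let x (i : Fin 4) : ℝ := if h : i.val < n then b.repr X ⟨i, h⟩ else 0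
      refine ⟨x 0, x 1, x 2, x 3, ?_⟩
      conv_lhs => rw [← b.sum_repr X]
      interval_cases n <;> simp [x, Fin.sum_univ_succ, add_assoc]
    · exact dif_neg (by simp; omega)

/-- Thorpe; Proposition on dimension ≤ 4. If `dim V ≤ 4` and
`R` is an algebraic curvature operator on `Λ²V` (self-adjoint with `b(R)=0`),
then `R` has strongly positive curvature if and only if `sec_R(σ) > 0` for
every nonzero decomposable `σ ∈ Λ²V`. -/
theorem dim_le_four_strongly_positive_iff_sec_pos
    {V E2 E4 : Type*}
    [NormedAddCommGroup V] [InnerProductSpace ℝ V] [FiniteDimensional ℝ V]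
    [NormedAddCommGroup E2] [InnerProductSpace ℝ E2] [FiniteDimensional ℝ E2]
    [NormedAddCommGroup E4] [InnerProductSpace ℝ E4] [FiniteDimensional ℝ E4]
    (hdim : Module.finrank ℝ V ≤ 4)
    (M : ExtModel V E2 E4)
    (R : E2 →ₗ[ℝ] E2) (hR_sym : R.IsSymmetric)
    (hR_bianchi : ∀ X Y Z W : V, M.bianchi R X Y Z W = 0) :
    (∃ ω : E4, IsPosDef (R + M.toOp ω)) ↔
      (∀ X Y : V, M.wedge2 X Y ≠ 0 → 0 < ⟪R (M.wedge2 X Y), M.wedge2 X Y⟫_ℝ) := by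
  constructor
  · rintro ⟨ω, hω⟩ X Y hXY
    have h := hω _ hXY
    rwa [LinearMap.add_apply, inner_add_left, M.inner_toOp_wedge2_self, add_zero] at h
  intro hsec
  obtain ⟨e, hspan, he⟩ := exists_four_spanning hdim
  set η := M.wedge4 (e 0) (e 1) (e 2) (e 3)
  have hpos {σ : E2} (hσ : σ ≠ 0) (hdec : ∃ X Y : V, σ = M.wedge2 X Y) : 0 < ⟪R σ, σ⟫_ℝ := by
    obtain ⟨X, Y, rfl⟩ := hdec
    exact hsec X Y hσ
  obtain ⟨t, ht⟩ := exists_isPosDef_add_smul (A := R) (B := M.toOp η) fun σ hσ hησ => by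
    refine hpos hσ ?_
    obtain ⟨a, b, c, d, f, g, rfl⟩ := M.exists_eq_bivector hspan σ
    rcases he with he | he
    · rw [show M.bivector (e 0) (e 1) (e 2) (e 3) a b c d f g
        = M.bivector (e 0) (e 1) (e 2) (e 3) a b 0 d 0 0 by simp [ExtModel.bivector, he]]
      exact M.exists_bivector_eq_wedge2 _ _ _ _ (by ring)
    · have hη : ⟪η, η⟫_ℝ = 1 := by
        rw [M.inner_wedge4 e e, show (Matrix.of fun i j : Fin 4 => ⟪e i, e j⟫_ℝ) = 1 by
          ext i j
          simp [orthonormal_iff_ite.mp he i j, Matrix.one_apply], Matrix.det_one]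
      rw [M.inner_toOp_bivector, hη] at hησ
      exact M.exists_bivector_eq_wedge2 _ _ _ _ (by linarith)
  exact ⟨t • η, by rwa [map_smul]⟩
end
end

section
/- Let g be a real Lie algebra with an inner product Q satisfying the ad-invariance Q([Z,X],Y) + Q(X,[Z,Y]) = 0 for all X, Y, Z ∈ g, let h ⊂ g be a Lie subalgebra and m its Q-orthogonal complement, and for X ∈ g write X_h for the Q-orthogonal projection onto h. Define the self-adjoint operator R on Λ²m by ⟨R(X∧Y), Z∧W⟩ = (1/4)Q([X,Y],[Z,W]) + (3/4)Q([X,Y]_h, [Z,W]_h) − 3·b(α)(X,Y,Z,W), where α is the self-adjoint operator on Λ²m with ⟨α(X∧Y), Z∧W⟩ = (1/4)Q([X,Y]_h, [Z,W]_h). Then: (i) R is an algebraic curvature operator (it satisfies b(R) = 0); (ii) R + 3b(α) is positive-semidefinite, so R has strongly nonnegative curvature. (R is the curvature operator of the normal homogeneous space G/H.) -/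
/- Common setup: an abstract model of the second and fourth exterior powers
`Λ²V` and `Λ⁴V` of a real inner product space `V`, with the induced inner
products, the identification of 4-vectors with self-adjoint operators on
`Λ²V`, and the Bianchi map. -/

noncomputable section

open scoped InnerProductSpace

/-- An operator on `Λ²V` whose values on decomposable 2-vectors are a positive combination of
Gram pairings of bilinear images of their factors is positive-semidefinite. -/
theorem ExtModel.isPosSemidef_of_inner_wedge2 {V E2 E4 F G : Type*}
    [NormedAddCommGroup V] [InnerProductSpace ℝ V]
    [NormedAddCommGroup E2] [InnerProductSpace ℝ E2]
    [NormedAddCommGroup E4] [InnerProductSpace ℝ E4]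
    [NormedAddCommGroup F] [InnerProductSpace ℝ F]
    [NormedAddCommGroup G] [InnerProductSpace ℝ G]
    (M : ExtModel V E2 E4) (S : E2 →ₗ[ℝ] E2) (A : V → V → F) (B : V → V → G) {a b : ℝ}
    (ha : 0 ≤ a) (hb : 0 ≤ b)
    (hS : ∀ X Y Z W : V, ⟪S (M.wedge2 X Y), M.wedge2 Z W⟫_ℝ
      = a * ⟪A X Y, A Z W⟫_ℝ + b * ⟪B X Y, B Z W⟫_ℝ) :
    IsPosSemidef S := by
  intro v
  have hv : v ∈ Submodule.span ℝ {σ : E2 | ∃ X Y : V, σ = M.wedge2 X Y} := by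
    simp [M.span_wedge2]
  obtain ⟨n, c, w, rfl⟩ := Submodule.mem_span_set'.1 hv
  choose X Y hXY using fun i => (w i).2
  have key : ⟪S (∑ i, c i • (w i : E2)), ∑ i, c i • (w i : E2)⟫_ℝ
      = a * ⟪∑ i, c i • A (X i) (Y i), ∑ i, c i • A (X i) (Y i)⟫_ℝ
        + b * ⟪∑ i, c i • B (X i) (Y i), ∑ i, c i • B (X i) (Y i)⟫_ℝ := by
    simp only [hXY, map_sum, map_smul, sum_inner, inner_sum, real_inner_smul_left,
      real_inner_smul_right, hS, Finset.mul_sum, ← Finset.sum_add_distrib]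
    refine Finset.sum_congr rfl fun i _ => Finset.sum_congr rfl fun j _ => ?_
    ring
  rw [key]
  exact add_nonneg (mul_nonneg ha real_inner_self_nonneg) (mul_nonneg hb real_inner_self_nonneg)

/-- Curvature operator of a normal homogeneous space. Let
`g` be a real Lie algebra (with Lie bracket `br`, a skew-symmetric bilinear
map satisfying the Jacobi identity) carrying an ad-invariant inner product
`Q = ⟪·,·⟫`, let `h ⊆ g` be a Lie subalgebra and `m = hᗮ` its `Q`-orthogonal
complement, and write `P X` (`= X_h`) for the `Q`-orthogonal projection of `X`
onto `h`. Let `α` be the self-adjoint operator on `Λ²m` with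
`⟪α(X∧Y), Z∧W⟫ = (1/4) Q([X,Y]_h, [Z,W]_h)`, let `βα ∈ Λ⁴m` be the 4-form
representing `b(α)`, and let `R` be the self-adjoint operator on `Λ²m` with
`⟪R(X∧Y), Z∧W⟫ = (1/4) Q([X,Y],[Z,W]) + (3/4) Q([X,Y]_h,[Z,W]_h)
− 3 b(α)(X,Y,Z,W)`. Then (i) `R` is an algebraic curvature operator
(`b(R) = 0`); and (ii) `R + 3 b(α)` is positive-semidefinite, so `R` has
strongly nonnegative curvature. -/
theorem normal_homogeneous_curvature_operator
    {g : Type*} [NormedAddCommGroup g] [InnerProductSpace ℝ g] [FiniteDimensional ℝ g]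
    (br : g →ₗ[ℝ] g →ₗ[ℝ] g)
    (hbr_skew : ∀ X : g, br X X = 0)
    (hbr_jacobi : ∀ X Y Z : g, br X (br Y Z) + br Y (br Z X) + br Z (br X Y) = 0)
    (hQ_ad : ∀ X Y Z : g, ⟪br Z X, Y⟫_ℝ + ⟪X, br Z Y⟫_ℝ = 0)
    (h : Submodule ℝ g)
    (hh_subalg : ∀ X ∈ h, ∀ Y ∈ h, br X Y ∈ h)
    (P : g →ₗ[ℝ] g)
    (hP_mem : ∀ X : g, P X ∈ h)
    (hP_perp : ∀ X : g, X - P X ∈ hᗮ)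
    {E2 E4 : Type*}
    [NormedAddCommGroup E2] [InnerProductSpace ℝ E2] [FiniteDimensional ℝ E2]
    [NormedAddCommGroup E4] [InnerProductSpace ℝ E4] [FiniteDimensional ℝ E4]
    (M : ExtModel (↥hᗮ) E2 E4)
    (α : E2 →ₗ[ℝ] E2)
    (hα : ∀ X Y Z W : ↥hᗮ,
      ⟪α (M.wedge2 X Y), M.wedge2 Z W⟫_ℝ
        = (1 / 4) * ⟪P (br (X : g) (Y : g)), P (br (Z : g) (W : g))⟫_ℝ)
    (βα : E4)
    (hβα : ∀ X Y Z W : ↥hᗮ,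
      ⟪βα, M.wedge4 X Y Z W⟫_ℝ = M.bianchi α X Y Z W)
    (R : E2 →ₗ[ℝ] E2) (hR_sym : R.IsSymmetric)
    (hR : ∀ X Y Z W : ↥hᗮ,
      ⟪R (M.wedge2 X Y), M.wedge2 Z W⟫_ℝ
        = (1 / 4) * ⟪br (X : g) (Y : g), br (Z : g) (W : g)⟫_ℝ
          + (3 / 4) * ⟪P (br (X : g) (Y : g)), P (br (Z : g) (W : g))⟫_ℝ
          - 3 * M.bianchi α X Y Z W) :
    (∀ X Y Z W : ↥hᗮ, M.bianchi R X Y Z W = 0) ∧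
    IsPosSemidef (R + M.toOp ((3 : ℝ) • βα)) ∧
    (∃ ω : E4, IsPosSemidef (R + M.toOp ω)) := by
  have hpos : IsPosSemidef (R + M.toOp ((3 : ℝ) • βα)) := by
    refine M.isPosSemidef_of_inner_wedge2 _ (fun X Y => br (X : g) (Y : g))
      (fun X Y => P (br (X : g) (Y : g))) (a := 1 / 4) (b := 3 / 4) (by norm_num) (by norm_num)
      fun X Y Z W => ?_
    rw [LinearMap.add_apply, inner_add_left, M.toOp_spec, real_inner_smul_left, hβα, hR]
    ring
  refine ⟨fun X Y Z W => ?_, hpos, _, hpos⟩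
  have hjac := congrArg (fun U : g => ⟪U, (W : g)⟫_ℝ) (hbr_jacobi X Y Z)
  simp only [inner_add_left, inner_zero_left] at hjac
  have hZ := hQ_ad (br (X : g) (Y : g)) W Z
  have hX := hQ_ad (br (Y : g) (Z : g)) W X
  have hY := hQ_ad (br (Z : g) (X : g)) W Y
  simp only [ExtModel.bianchi, hR, hα]
  linarith
end
end

section
/- Strong fatness implies fatness: in the setting of a real Lie algebra g with an inner product Q and mutually Q-orthogonal subspaces m and p, if there exists τ ∈ Λ²m⊗Λ²p such that the operator F + τ restricted to m⊗p is positive-definite, then [X,Y] ≠ 0 for all nonzero X ∈ m and nonzero Y ∈ p. -/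
/- Common setup: an abstract model of the second and fourth exterior powers
`Λ²V` and `Λ⁴V` of a real inner product space `V`, with the induced inner
products, the identification of 4-vectors with self-adjoint operators on
`Λ²V`, and the Bianchi map. -/

noncomputable section

open scoped InnerProductSpace

namespace ExtModel

variable {V E2 E4 : Type*} [NormedAddCommGroup V] [InnerProductSpace ℝ V]
  [NormedAddCommGroup E2] [InnerProductSpace ℝ E2]
  [NormedAddCommGroup E4] [InnerProductSpace ℝ E4]

/-- A 4-vector with a repeated pair of factors vanishes. -/
theorem wedge4_repeated_pair (M : ExtModel V E2 E4) (X Y : V) : M.wedge4 X Y X Y = 0 := by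
  have h := M.wedge4_self₂₃ X (X + Y) Y
  simpa [M.wedge4_self₁₂, M.wedge4_self₂₃] using h

end ExtModel

/-- Strong fatness implies fatness. Let `g` be a real Lie
algebra (with Lie bracket `br`) carrying an inner product `Q = ⟪·,·⟫`, and let
`m, p ⊆ g` be mutually `Q`-orthogonal subspaces. Let `F = L*L` be the
self-adjoint operator on the subspace `m⊗p ⊆ Λ²(m⊕p)` induced by
`L(X∧Y) = [X,Y]`, i.e. `⟪F(X∧Y), Z∧W⟫ = ⟪[X,Y],[Z,W]⟫` for `X,Z ∈ m` and
`Y,W ∈ p`. If there exists `τ ∈ Λ²m⊗Λ²p` such that `F + τ` restricted to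
`m⊗p` is positive-definite, then `[X,Y] ≠ 0` for all nonzero `X ∈ m` and
nonzero `Y ∈ p`. -/
theorem strong_fatness_implies_fatness
    {g : Type*} [NormedAddCommGroup g] [InnerProductSpace ℝ g] [FiniteDimensional ℝ g]
    (br : g →ₗ[ℝ] g →ₗ[ℝ] g)
    (hbr_skew : ∀ X : g, br X X = 0)
    (hbr_jacobi : ∀ X Y Z : g, br X (br Y Z) + br Y (br Z X) + br Z (br X Y) = 0)
    {E2 E4 : Type*}
    [NormedAddCommGroup E2] [InnerProductSpace ℝ E2] [FiniteDimensional ℝ E2]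
    [NormedAddCommGroup E4] [InnerProductSpace ℝ E4] [FiniteDimensional ℝ E4]
    (M : ExtModel g E2 E4)
    (m p : Submodule ℝ g)
    (horth : ∀ X ∈ m, ∀ Y ∈ p, ⟪X, Y⟫_ℝ = 0)
    (F : E2 →ₗ[ℝ] E2)
    (hF : ∀ X Z : g, X ∈ m → Z ∈ m → ∀ Y W : g, Y ∈ p → W ∈ p →
      ⟪F (M.wedge2 X Y), M.wedge2 Z W⟫_ℝ = ⟪br X Y, br Z W⟫_ℝ)
    (τ : E4)
    (hτ : τ ∈ Submodule.span ℝ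
      {ω : E4 | ∃ X Y Z W : g, X ∈ m ∧ Y ∈ m ∧ Z ∈ p ∧ W ∈ p ∧ ω = M.wedge4 X Y Z W})
    (hpos : ∀ σ ∈ Submodule.span ℝ
        {σ : E2 | ∃ X Y : g, X ∈ m ∧ Y ∈ p ∧ σ = M.wedge2 X Y},
      σ ≠ 0 → 0 < ⟪(F + M.toOp τ) σ, σ⟫_ℝ) :
    ∀ X ∈ m, X ≠ 0 → ∀ Y ∈ p, Y ≠ 0 → br X Y ≠ 0 := by
  intro X hX hX0 Y hY hY0 hbr
  have hne : M.wedge2 X Y ≠ 0 := by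
    intro h
    have hinner := M.inner_wedge2 X Y X Y
    rw [h, inner_zero_left, horth X hX Y hY, zero_mul, sub_zero] at hinner
    exact mul_ne_zero (inner_self_ne_zero.mpr hX0) (inner_self_ne_zero.mpr hY0) hinner.symm
  have h := hpos _ (Submodule.subset_span ⟨X, Y, hX, hY, rfl⟩) hne
  rw [LinearMap.add_apply, inner_add_left, hF X X hX hX Y Y hY hY, hbr, inner_zero_left,
    M.toOp_spec, M.wedge4_repeated_pair, inner_zero_right, add_zero] at h
  exact lt_irrefl 0 h
end
end

section
/- Let V be a real inner product space of dimension 2n (n ≥ 1) with an orthogonal complex structure J (J² = −id and ⟨JX, JY⟩ = ⟨X, Y⟩), and let ω_J ∈ Λ²V be the Kähler form ω_J(X,Y) = ⟨JX, Y⟩. Define the self-adjoint operator R on Λ²V (the Fubini–Study curvature operator of ℂPⁿ) by ⟨R(X∧Y), Z∧W⟩ = ⟨X,Z⟩⟨Y,W⟩ − ⟨X,W⟩⟨Y,Z⟩ + ⟨JX,Z⟩⟨JY,W⟩ − ⟨JX,W⟩⟨JY,Z⟩ + 2⟨JX,Y⟩⟨JZ,W⟩. Then there exists c > 0 such that R +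 c·(ω_J ∧ ω_J) is positive-definite; in particular, R has strongly positive curvature. -/
/- Common setup: an abstract model of the second and fourth exterior powers
`Λ²V` and `Λ⁴V` of a real inner product space `V`, with the induced inner
products, the identification of 4-vectors with self-adjoint operators on
`Λ²V`, and the Bianchi map. -/

noncomputable section

open scoped InnerProductSpace

namespace ExtModel

variable {V E2 E4 : Type*} [NormedAddCommGroup V] [InnerProductSpace ℝ V]
  [NormedAddCommGroup E2] [InnerProductSpace ℝ E2]
  [NormedAddCommGroup E4] [InnerProductSpace ℝ E4]

/-- To prove a linear statement about `Λ²V` it suffices to check it on decomposable 2-vectors. -/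
theorem wedge2_induction (M : ExtModel V E2 E4) {p : E2 → Prop}
    (wedge : ∀ X Y, p (M.wedge2 X Y)) (add : ∀ σ τ, p σ → p τ → p (σ + τ))
    (smul : ∀ (a : ℝ) σ, p σ → p (a • σ)) (σ : E2) : p σ := by
  have hσ : σ ∈ Submodule.span ℝ {σ : E2 | ∃ X Y : V, σ = M.wedge2 X Y} :=
    M.span_wedge2 ▸ Submodule.mem_top
  induction hσ using Submodule.span_induction with
  | mem x hx => obtain ⟨X, Y, rfl⟩ := hx; exact wedge X Y
  | zero => simpa using wedge 0 0
  | add x y _ _ hx hy => exact add x y hx hy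
  | smul a x _ hx => exact smul a x hx

/-- Laplace expansion of a `4 × 4` Gram determinant along two complementary pairs of rows. -/
theorem inner_wedge4_eq (M : ExtModel V E2 E4) (A B C D X Y Z W : V) :
    ⟪M.wedge4 A B C D, M.wedge4 X Y Z W⟫_ℝ =
      ⟪M.wedge2 A B, M.wedge2 X Y⟫_ℝ * ⟪M.wedge2 C D, M.wedge2 Z W⟫_ℝ
      - ⟪M.wedge2 A B, M.wedge2 X Z⟫_ℝ * ⟪M.wedge2 C D, M.wedge2 Y W⟫_ℝ
      + ⟪M.wedge2 A B, M.wedge2 X W⟫_ℝ * ⟪M.wedge2 C D, M.wedge2 Y Z⟫_ℝ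
      + ⟪M.wedge2 A B, M.wedge2 Y Z⟫_ℝ * ⟪M.wedge2 C D, M.wedge2 X W⟫_ℝ
      - ⟪M.wedge2 A B, M.wedge2 Y W⟫_ℝ * ⟪M.wedge2 C D, M.wedge2 X Z⟫_ℝ
      + ⟪M.wedge2 A B, M.wedge2 Z W⟫_ℝ * ⟪M.wedge2 C D, M.wedge2 X Y⟫_ℝ := by
  have h := M.inner_wedge4 ![A, B, C, D] ![X, Y, Z, W]
  simp only [Matrix.cons_val] at h
  rw [h]
  simp only [M.inner_wedge2, Matrix.det_succ_row_zero, Matrix.of_apply, Matrix.submatrix_apply,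
    Fin.sum_univ_succ]
  simp [Fin.succAbove, Fin.lt_def]
  ring

theorem inner_wedge22 (M : ExtModel V E2 E4) (σ τ : E2) (X Y Z W : V) :
    ⟪M.wedge22 σ τ, M.wedge4 X Y Z W⟫_ℝ =
      ⟪σ, M.wedge2 X Y⟫_ℝ * ⟪τ, M.wedge2 Z W⟫_ℝ
      - ⟪σ, M.wedge2 X Z⟫_ℝ * ⟪τ, M.wedge2 Y W⟫_ℝ
      + ⟪σ, M.wedge2 X W⟫_ℝ * ⟪τ, M.wedge2 Y Z⟫_ℝ
      + ⟪σ, M.wedge2 Y Z⟫_ℝ * ⟪τ, M.wedge2 X W⟫_ℝ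
      - ⟪σ, M.wedge2 Y W⟫_ℝ * ⟪τ, M.wedge2 X Z⟫_ℝ
      + ⟪σ, M.wedge2 Z W⟫_ℝ * ⟪τ, M.wedge2 X Y⟫_ℝ := by
  induction σ using M.wedge2_induction with
  | add σ σ' h h' => simp only [map_add, LinearMap.add_apply, inner_add_left, h, h']; ring
  | smul a σ h =>
    simp only [map_smul, LinearMap.smul_apply, real_inner_smul_left, h]; ring
  | wedge A B =>
    induction τ using M.wedge2_induction with
    | add τ τ' h h' => simp only [map_add, inner_add_left, h, h']; ring
    | smul a τ h => simp only [map_smul, real_inner_smul_left, h]; ring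
    | wedge C D => rw [M.wedge22_spec, M.inner_wedge4_eq]

/-- Two operators on `Λ²V` agree if their matrix entries on decomposable 2-vectors agree. -/
theorem op_ext (M : ExtModel V E2 E4) {S T : E2 →ₗ[ℝ] E2}
    (h : ∀ X Y Z W, ⟪S (M.wedge2 X Y), M.wedge2 Z W⟫_ℝ = ⟪T (M.wedge2 X Y), M.wedge2 Z W⟫_ℝ) :
    S = T := by
  ext σ
  induction σ using M.wedge2_induction with
  | add σ σ' h h' => simp only [map_add, h, h']
  | smul a σ h => simp only [map_smul, h]
  | wedge X Y =>
    refine ext_inner_right ℝ fun τ => ?_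
    induction τ using M.wedge2_induction with
    | add τ τ' h h' => simp only [inner_add_right, h, h']
    | smul a τ h => simp only [real_inner_smul_right, h]
    | wedge Z W => exact h X Y Z W

end ExtModel

/-- The Fubini–Study curvature operator of `ℂPⁿ` has
strongly positive curvature. Let `V` be a real inner product space of
dimension `2n` (`n ≥ 1`) with an orthogonal complex structure `J`, let
`ωJ ∈ Λ²V` be the Kähler form (`ωJ(X,Y) = ⟪J X, Y⟫`, identified with a
2-vector via the inner product), and let `R` be the self-adjoint operator on
`Λ²V` given by `⟪R(X∧Y), Z∧W⟫ = ⟪X,Z⟫⟪Y,W⟫ − ⟪X,W⟫⟪Y,Z⟫ + ⟪JX,Z⟫⟪JY,W⟫ −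
⟪JX,W⟫⟪JY,Z⟫ + 2⟪JX,Y⟫⟪JZ,W⟫`. Then there exists `c > 0` such that
`R + c (ωJ ∧ ωJ)` is positive-definite; in particular `R` has strongly
positive curvature. -/
theorem fubini_study_strongly_positive
    {V E2 E4 : Type*}
    [NormedAddCommGroup V] [InnerProductSpace ℝ V] [FiniteDimensional ℝ V]
    [NormedAddCommGroup E2] [InnerProductSpace ℝ E2] [FiniteDimensional ℝ E2]
    [NormedAddCommGroup E4] [InnerProductSpace ℝ E4] [FiniteDimensional ℝ E4]
    (n : ℕ) (hn : 1 ≤ n) (hdim : Module.finrank ℝ V = 2 * n)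
    (M : ExtModel V E2 E4)
    (J : V →ₗ[ℝ] V)
    (hJ_sq : ∀ X : V, J (J X) = -X)
    (hJ_orth : ∀ X Y : V, ⟪J X, J Y⟫_ℝ = ⟪X, Y⟫_ℝ)
    (ωJ : E2)
    (hωJ : ∀ X Y : V, ⟪ωJ, M.wedge2 X Y⟫_ℝ = ⟪J X, Y⟫_ℝ)
    (R : E2 →ₗ[ℝ] E2) (hR_sym : R.IsSymmetric)
    (hR : ∀ X Y Z W : V,
      ⟪R (M.wedge2 X Y), M.wedge2 Z W⟫_ℝ
        = ⟪X, Z⟫_ℝ * ⟪Y, W⟫_ℝ - ⟪X, W⟫_ℝ * ⟪Y, Z⟫_ℝ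
          + ⟪J X, Z⟫_ℝ * ⟪J Y, W⟫_ℝ - ⟪J X, W⟫_ℝ * ⟪J Y, Z⟫_ℝ
          + 2 * ⟪J X, Y⟫_ℝ * ⟪J Z, W⟫_ℝ) :
    (∃ c : ℝ, 0 < c ∧ IsPosDef (R + M.toOp (c • M.wedge22 ωJ ωJ))) ∧
    (∃ ω : E4, IsPosDef (R + M.toOp ω)) := by
  have key : R + M.toOp ((1 / 2 : ℝ) • M.wedge22 ωJ ωJ) =
      LinearMap.id + (3 : ℝ) • (innerₗ E2 ωJ).smulRight ωJ := by
    refine M.op_ext fun X Y Z W => ?_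
    simp only [LinearMap.add_apply, LinearMap.smul_apply, LinearMap.id_apply,
      LinearMap.smulRight_apply, innerₗ_apply_apply, inner_add_left, real_inner_smul_left,
      M.toOp_spec, M.inner_wedge22, M.inner_wedge2, hR, hωJ]
    ring
  have pos : IsPosDef (R + M.toOp ((1 / 2 : ℝ) • M.wedge22 ωJ ωJ)) := by
    intro v hv
    rw [key]
    simp only [LinearMap.add_apply, LinearMap.smul_apply, LinearMap.id_apply,
      LinearMap.smulRight_apply, innerₗ_apply_apply, inner_add_left, real_inner_smul_left]
    have := real_inner_self_pos.mpr hv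
    nlinarith [mul_self_nonneg ⟪ωJ, v⟫_ℝ]
  exact ⟨⟨1 / 2, by norm_num, pos⟩, _, pos⟩
end
end

section
/- Strong fatness for the Wallach flag manifold W⁶ = SU(3)/T²: let g = su(3) (traceless skew-Hermitian complex 3×3 matrices) with inner product Q(X,Y) = −Re tr(XY), let k = {diag(A, −tr A) : A ∈ u(2)} (u(2) embedded in the upper-left 2×2 block), and let h ⊂ k be the subalgebra of diagonal matrices in su(3). Let m be the Q-orthogonal complement of k in g and p the Q-orthogonal complement of h in k. Then there exists τ ∈ Λ²m⊗Λ²p such that the operator F + τ restricted to m⊗p is positive-definite. -/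
/- Common setup: an abstract model of the second and fourth exterior powers
`Λ²V` and `Λ⁴V` of a real inner product space `V`, with the induced inner
products, the identification of 4-vectors with self-adjoint operators on
`Λ²V`, and the Bianchi map. -/

noncomputable section

open scoped InnerProductSpace

lemma ExtModel.inner_wedge4_of_orthogonal {V E2 E4 : Type*}
    [NormedAddCommGroup V] [InnerProductSpace ℝ V]
    [NormedAddCommGroup E2] [InnerProductSpace ℝ E2]
    [NormedAddCommGroup E4] [InnerProductSpace ℝ E4] (M : ExtModel V E2 E4)
    {a b p q x y u v : V} (hau : ⟪a, u⟫_ℝ = 0) (hav : ⟪a, v⟫_ℝ = 0) (hbu : ⟪b, u⟫_ℝ = 0)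
    (hbv : ⟪b, v⟫_ℝ = 0) (hpx : ⟪p, x⟫_ℝ = 0) (hpy : ⟪p, y⟫_ℝ = 0) (hqx : ⟪q, x⟫_ℝ = 0)
    (hqy : ⟪q, y⟫_ℝ = 0) :
    ⟪M.wedge4 a b p q, M.wedge4 x u y v⟫_ℝ
      = -((⟪a, x⟫_ℝ * ⟪b, y⟫_ℝ - ⟪a, y⟫_ℝ * ⟪b, x⟫_ℝ)
        * (⟪p, u⟫_ℝ * ⟪q, v⟫_ℝ - ⟪p, v⟫_ℝ * ⟪q, u⟫_ℝ)) := by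
  refine (M.inner_wedge4 ![a, b, p, q] ![x, u, y, v]).trans ?_
  simp [Matrix.det_succ_row_zero, Fin.sum_univ_succ, Fin.succAbove, hau, hav, hbu, hbv, hpx, hpy,
    hqx, hqy, -inner_self_eq_norm_sq_to_K]
  ring

open scoped ComplexConjugate

section

open Matrix

/-- The element of `m ≅ ℂ²` with off-diagonal column `(z, w)`. -/
def mMat (z w : ℂ) : Matrix (Fin 3) (Fin 3) ℂ :=
  !![0, 0, z; 0, 0, w; -conj z, -conj w, 0]

/-- The element of `p ≅ ℂ` with upper off-diagonal entry `u`. -/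
def pMat (u : ℂ) : Matrix (Fin 3) (Fin 3) ℂ :=
  !![0, u, 0; -conj u, 0, 0; 0, 0, 0]

lemma mMat_skew (z w : ℂ) : (mMat z w)ᴴ = -mMat z w ∧ (mMat z w).trace = 0 := by
  constructor
  · ext i j
    fin_cases i <;> fin_cases j <;> simp [mMat]
  · simp [mMat, trace_fin_three]

lemma pMat_skew (u : ℂ) : (pMat u)ᴴ = -pMat u ∧ (pMat u).trace = 0 := by
  constructor
  · ext i j
    fin_cases i <;> fin_cases j <;> simp [pMat]
  · simp [pMat, trace_fin_three]

lemma mMat_commutator_pMat (z w u : ℂ) :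
    mMat z w * pMat u - pMat u * mMat z w = mMat (-(u * w)) (conj u * z) := by
  ext i j
  fin_cases i <;> fin_cases j <;>
    simp [mMat, pMat] <;> ring

lemma neg_re_trace_mMat_mul_mMat (z w z' w' : ℂ) :
    -(trace (mMat z w * mMat z' w')).re
      = 2 * (z.re * z'.re + z.im * z'.im + w.re * w'.re + w.im * w'.im) := by
  simp [mMat, trace_fin_three]
  ring

lemma neg_re_trace_pMat_mul_pMat (u v : ℂ) :
    -(trace (pMat u * pMat v)).re = 2 * (u.re * v.re + u.im * v.im) := by
  simp [pMat, trace_fin_three]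
  ring

lemma neg_re_trace_mMat_mul_pMat (z w u : ℂ) :
    -(trace (mMat z w * pMat u)).re = 0 := by
  simp [mMat, pMat, trace_fin_three]

lemma apply_eq_neg_conj_of_skew {n : Type*} {A : Matrix n n ℂ} (hA : Aᴴ = -A) (i j : n) :
    A j i = -conj (A i j) := by
  have h : conj (A i j) = -A j i := congrFun (congrFun hA j) i
  rw [h, neg_neg]

lemma re_apply_self_of_skew {n : Type*} {A : Matrix n n ℂ} (hA : Aᴴ = -A) (i : n) :
    (A i i).re = 0 := by
  have h := congrArg Complex.re (apply_eq_neg_conj_of_skew hA i i)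
  simp only [Complex.neg_re, Complex.conj_re] at h
  linarith

/-- A skew-Hermitian matrix that is trace-orthogonal to its own `u(2)`-block lies in `m`. -/
lemma eq_mMat_of_orthogonal {A : Matrix (Fin 3) (Fin 3) ℂ} (hA : Aᴴ = -A)
    (h : -(trace (!![A 0 0, A 0 1, 0; A 1 0, A 1 1, 0; 0, 0, A 2 2] * A)).re = 0) :
    A = mMat (A 0 2) (A 1 2) := by
  have hre := re_apply_self_of_skew hA
  have h10 := apply_eq_neg_conj_of_skew hA 0 1
  simp [trace_fin_three, vecMul, dotProduct, Fin.sum_univ_three, hre, h10] at h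
  have h00 : A 0 0 = 0 := Complex.ext (hre 0) (by simp; nlinarith)
  have h11 : A 1 1 = 0 := Complex.ext (hre 1) (by simp; nlinarith)
  have h22 : A 2 2 = 0 := Complex.ext (hre 2) (by simp; nlinarith)
  have h01 : A 0 1 = 0 := Complex.ext (by simp; nlinarith) (by simp; nlinarith)
  rw [h01, map_zero, neg_zero] at h10
  ext i j
  fin_cases i <;> fin_cases j <;>
    simp [mMat, h00, h11, h22, h01, h10, apply_eq_neg_conj_of_skew hA 0 2,
      apply_eq_neg_conj_of_skew hA 1 2]

/-- A block-diagonal skew-Hermitian matrix that is trace-orthogonal to its own diagonal lies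
in `p`. -/
lemma eq_pMat_of_orthogonal {A : Matrix (Fin 3) (Fin 3) ℂ} (hA : Aᴴ = -A)
    (h02 : A 0 2 = 0) (h12 : A 1 2 = 0) (h : -(trace (diagonal (fun i => A i i) * A)).re = 0) :
    A = pMat (A 0 1) := by
  have hre := re_apply_self_of_skew hA
  simp [trace_fin_three, hre] at h
  have h00 : A 0 0 = 0 := Complex.ext (hre 0) (by simp; nlinarith)
  have h11 : A 1 1 = 0 := Complex.ext (hre 1) (by simp; nlinarith)
  have h22 : A 2 2 = 0 := Complex.ext (hre 2) (by simp; nlinarith)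
  ext i j
  fin_cases i <;> fin_cases j <;>
    simp [pMat, h00, h11, h22, h02, h12, apply_eq_neg_conj_of_skew hA 0 1,
      apply_eq_neg_conj_of_skew hA 0 2, apply_eq_neg_conj_of_skew hA 1 2]

end

open Matrix in
/-- Strong fatness for the Wallach flag manifold
`W⁶ = SU(3)/T²`. Here `g` is (isomorphic, via `φ`, to) the Lie algebra
`su(3)` of traceless skew-Hermitian complex `3×3` matrices, with inner product
`Q(X,Y) = −Re tr(XY)` and bracket `[X,Y] = XY − YX`; `K` corresponds to
`u(2) = {diag(A, −tr A) : A ∈ u(2)}` (upper-left `2×2` block) and `H ⊆ K` to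
the diagonal matrices in `su(3)`; `m = Kᗮ` and `p = Hᗮ ⊓ K` are the
`Q`-orthogonal complements of `K` in `g` and of `H` in `K`. Conclusion: there
exists `τ ∈ Λ²m⊗Λ²p` such that `F + τ` restricted to `m⊗p` is
positive-definite, where `⟪F(X∧Y), Z∧W⟫ = ⟪[X,Y],[Z,W]⟫` for `X,Z ∈ m`,
`Y,W ∈ p`. -/
theorem strong_fatness_W6
    {g : Type*} [NormedAddCommGroup g] [InnerProductSpace ℝ g] [FiniteDimensional ℝ g]
    (br : g →ₗ[ℝ] g →ₗ[ℝ] g)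
    (φ : g →ₗ[ℝ] Matrix (Fin 3) (Fin 3) ℂ)
    (hφ_inj : Function.Injective φ)
    (hφ_range : ∀ A : Matrix (Fin 3) (Fin 3) ℂ,
      (∃ X : g, φ X = A) ↔ (Aᴴ = -A ∧ Matrix.trace A = 0))
    (hφ_br : ∀ X Y : g, φ (br X Y) = φ X * φ Y - φ Y * φ X)
    (hQ : ∀ X Y : g, ⟪X, Y⟫_ℝ = -(Matrix.trace (φ X * φ Y)).re)
    (K H : Submodule ℝ g)
    (hK : ∀ X : g, X ∈ K ↔
      ((φ X) 0 2 = 0 ∧ (φ X) 1 2 = 0 ∧ (φ X) 2 0 = 0 ∧ (φ X) 2 1 = 0))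
    (hH : ∀ X : g, X ∈ H ↔ (∀ i j : Fin 3, i ≠ j → (φ X) i j = 0))
    {E2 E4 : Type*}
    [NormedAddCommGroup E2] [InnerProductSpace ℝ E2] [FiniteDimensional ℝ E2]
    [NormedAddCommGroup E4] [InnerProductSpace ℝ E4] [FiniteDimensional ℝ E4]
    (M : ExtModel g E2 E4)
    (F : E2 →ₗ[ℝ] E2)
    (hF : ∀ X Z : g, X ∈ Kᗮ → Z ∈ Kᗮ → ∀ Y W : g, Y ∈ Hᗮ ⊓ K → W ∈ Hᗮ ⊓ K →
      ⟪F (M.wedge2 X Y), M.wedge2 Z W⟫_ℝ = ⟪br X Y, br Z W⟫_ℝ) :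
    ∃ τ ∈ Submodule.span ℝ
        {ω : E4 | ∃ X Y Z W : g, X ∈ Kᗮ ∧ Y ∈ Kᗮ ∧ Z ∈ Hᗮ ⊓ K ∧ W ∈ Hᗮ ⊓ K ∧
          ω = M.wedge4 X Y Z W},
      ∀ σ ∈ Submodule.span ℝ
          {σ : E2 | ∃ X Y : g, X ∈ Kᗮ ∧ Y ∈ Hᗮ ⊓ K ∧ σ = M.wedge2 X Y},
        σ ≠ 0 → 0 < ⟪(F + M.toOp τ) σ, σ⟫_ℝ := by
  have lift (A : Matrix (Fin 3) (Fin 3) ℂ) (h : Aᴴ = -A ∧ trace A = 0) : ∃ X, φ X = A :=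
    (hφ_range A).2 h
  have mem_m {X : g} {z w : ℂ} (hX : φ X = mMat z w) : X ∈ Kᗮ := by
    rw [Submodule.mem_orthogonal]
    intro Y hY
    obtain ⟨h1, h2, h3, h4⟩ := (hK Y).1 hY
    rw [hQ, hX]
    simp [mMat, trace_fin_three, Matrix.mul_apply, Fin.sum_univ_three, h1, h2, h3, h4]
  have mem_p {X : g} {u : ℂ} (hX : φ X = pMat u) : X ∈ Hᗮ ⊓ K := by
    refine ⟨?_, ?_⟩
    · rw [SetLike.mem_coe, Submodule.mem_orthogonal]
      intro Y hY
      have h := (hH Y).1 hY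
      rw [hQ, hX]
      simp [pMat, trace_fin_three, Matrix.mul_apply, Fin.sum_univ_three, h 0 1 (by decide),
        h 1 0 (by decide)]
    · simp [hK, hX, pMat]
  have of_mem_m {X : g} (hX : X ∈ Kᗮ) : ∃ z w, φ X = mMat z w := by
    obtain ⟨hs, ht⟩ := (hφ_range (φ X)).1 ⟨X, rfl⟩
    obtain ⟨D, hD⟩ := lift
      !![φ X 0 0, φ X 0 1, 0; φ X 1 0, φ X 1 1, 0; 0, 0, φ X 2 2] (by
        constructor
        · ext i j
          have := congrFun (congrFun hs i) j
          fin_cases i <;> fin_cases j <;> first | (simp; done) | simpa using this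
        · simpa [trace_fin_three] using ht)
    refine ⟨_, _, eq_mMat_of_orthogonal hs ?_⟩
    rw [← hD, ← hQ]
    exact (Submodule.mem_orthogonal _ _).1 hX D (by simp [hK, hD])
  have of_mem_p {X : g} (hX : X ∈ Hᗮ ⊓ K) : ∃ u, φ X = pMat u := by
    obtain ⟨hs, ht⟩ := (hφ_range (φ X)).1 ⟨X, rfl⟩
    obtain ⟨hXH, hXK⟩ := hX
    obtain ⟨h1, h2, -, -⟩ := (hK X).1 hXK
    obtain ⟨D, hD⟩ := lift (diagonal fun i => φ X i i) (by
        constructor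
        · ext i j
          have := congrFun (congrFun hs i) j
          fin_cases i <;> fin_cases j <;> first | (simp; done) | simpa using this
        · rw [trace_diagonal]
          exact ht)
    refine ⟨_, eq_pMat_of_orthogonal hs h1 h2 ?_⟩
    rw [← hD, ← hQ]
    refine (Submodule.mem_orthogonal _ _).1 hXH D ((hH D).2 fun i j hij => ?_)
    rw [hD, diagonal_apply_ne _ hij]
  obtain ⟨P, hP⟩ := lift _ (pMat_skew 1)
  obtain ⟨R, hR⟩ := lift _ (pMat_skew Complex.I)
  obtain ⟨a, ha⟩ := lift _ (mMat_skew 1 0)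
  obtain ⟨b, hb⟩ := lift _ (mMat_skew Complex.I 0)
  obtain ⟨c, hc⟩ := lift _ (mMat_skew 0 1)
  obtain ⟨d, hd⟩ := lift _ (mMat_skew 0 Complex.I)
  have p_coord {Y : g} (hY : Y ∈ Hᗮ ⊓ K) : ∃ s t : ℝ, Y = s • P + t • R := by
    obtain ⟨u, hu⟩ := of_mem_p hY
    refine ⟨u.re, u.im, hφ_inj ?_⟩
    rw [map_add, map_smul, map_smul, hu, hP, hR]
    ext i j
    fin_cases i <;> fin_cases j <;> simp [pMat, Complex.ext_iff]
  have normal_form : ∀ σ ∈ Submodule.span ℝ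
      {σ : E2 | ∃ X Y : g, X ∈ Kᗮ ∧ Y ∈ Hᗮ ⊓ K ∧ σ = M.wedge2 X Y},
      ∃ A ∈ Kᗮ, ∃ B ∈ Kᗮ, σ = M.wedge2 A P + M.wedge2 B R := by
    intro σ hσ
    induction hσ using Submodule.span_induction with
    | mem x h =>
      obtain ⟨X, Y, hX, hY, rfl⟩ := h
      obtain ⟨s, t, rfl⟩ := p_coord hY
      exact ⟨s • X, Kᗮ.smul_mem _ hX, t • X, Kᗮ.smul_mem _ hX, by simp⟩
    | zero => exact ⟨0, Kᗮ.zero_mem, 0, Kᗮ.zero_mem, by simp⟩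
    | add x y _ _ hx hy =>
      obtain ⟨A, hA, B, hB, rfl⟩ := hx
      obtain ⟨A', hA', B', hB', rfl⟩ := hy
      refine ⟨A + A', Kᗮ.add_mem hA hA', B + B', Kᗮ.add_mem hB hB', ?_⟩
      simp only [map_add, LinearMap.add_apply]
      abel
    | smul r x _ hx =>
      obtain ⟨A, hA, B, hB, rfl⟩ := hx
      exact ⟨r • A, Kᗮ.smul_mem _ hA, r • B, Kᗮ.smul_mem _ hB, by simp⟩
  refine ⟨(1 / 8 : ℝ) • (M.wedge4 a b P R - M.wedge4 c d P R), ?_, ?_⟩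
  · refine Submodule.smul_mem _ _ (Submodule.sub_mem _ ?_ ?_) <;> refine Submodule.subset_span ?_
    · exact ⟨a, b, P, R, mem_m ha, mem_m hb, mem_p hP, mem_p hR, rfl⟩
    · exact ⟨c, d, P, R, mem_m hc, mem_m hd, mem_p hP, mem_p hR, rfl⟩
  intro σ hσ hσ0
  obtain ⟨A, hA, B, hB, rfl⟩ := normal_form σ hσ
  obtain ⟨z, w, hzw⟩ := of_mem_m hA
  obtain ⟨z', w', hzw'⟩ := of_mem_m hB
  have hPp := mem_p hP
  have hRp := mem_p hR
  have bracket {X Y : g} {z w u : ℂ} (hX : φ X = mMat z w) (hY : φ Y = pMat u) :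
      φ (br X Y) = mMat (-(u * w)) (conj u * z) := by
    rw [hφ_br, hX, hY, mMat_commutator_pMat]
  have inner_mm {X Y : g} {z w z' w' : ℂ} (hX : φ X = mMat z w) (hY : φ Y = mMat z' w') :
      ⟪X, Y⟫_ℝ = 2 * (z.re * z'.re + z.im * z'.im + w.re * w'.re + w.im * w'.im) := by
    rw [hQ, hX, hY, neg_re_trace_mMat_mul_mMat]
  have inner_pp {X Y : g} {u v : ℂ} (hX : φ X = pMat u) (hY : φ Y = pMat v) :
      ⟪X, Y⟫_ℝ = 2 * (u.re * v.re + u.im * v.im) := by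
    rw [hQ, hX, hY, neg_re_trace_pMat_mul_pMat]
  have inner_mp {X Y : g} {z w u : ℂ} (hX : φ X = mMat z w) (hY : φ Y = pMat u) :
      ⟪X, Y⟫_ℝ = 0 := by
    rw [hQ, hX, hY, neg_re_trace_mMat_mul_pMat]
  have inner_pm {X Y : g} {z w u : ℂ} (hX : φ X = pMat u) (hY : φ Y = mMat z w) :
      ⟪X, Y⟫_ℝ = 0 := by
    rw [real_inner_comm, inner_mp hY hX]
  have inner4 {e f X Y U V : g} {ze we zf wf z w z' w' u v : ℂ} (he : φ e = mMat ze we)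
      (hf : φ f = mMat zf wf) (hX : φ X = mMat z w) (hY : φ Y = mMat z' w') (hU : φ U = pMat u)
      (hV : φ V = pMat v) :=
    M.inner_wedge4_of_orthogonal (inner_mp he hU) (inner_mp he hV) (inner_mp hf hU)
      (inner_mp hf hV) (inner_pm hP hX) (inner_pm hP hY) (inner_pm hR hX) (inner_pm hR hY)
  have F_part : ⟪F (M.wedge2 A P + M.wedge2 B R), M.wedge2 A P + M.wedge2 B R⟫_ℝ
      = 2 * ((w.re - w'.im) ^ 2 + (w.im + w'.re) ^ 2 + (z.re + z'.im) ^ 2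
        + (z.im - z'.re) ^ 2) := by
    simp only [map_add, inner_add_left, inner_add_right, hF _ _ hA hA _ _ hPp hPp,
      hF _ _ hA hB _ _ hPp hRp, hF _ _ hB hA _ _ hRp hPp, hF _ _ hB hB _ _ hRp hRp,
      inner_mm (bracket hzw hP) (bracket hzw hP), inner_mm (bracket hzw hP) (bracket hzw' hR),
      inner_mm (bracket hzw' hR) (bracket hzw hP), inner_mm (bracket hzw' hR) (bracket hzw' hR)]
    simp
    ring
  have τ_part : ⟪M.toOp ((1 / 8 : ℝ) • (M.wedge4 a b P R - M.wedge4 c d P R))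
        (M.wedge2 A P + M.wedge2 B R), M.wedge2 A P + M.wedge2 B R⟫_ℝ
      = 4 * (w.re * w'.im - w.im * w'.re - z.re * z'.im + z.im * z'.re) := by
    simp only [map_add, inner_add_left, inner_add_right, M.toOp_spec, inner_smul_left,
      inner_sub_left, inner4 ha hb hzw hzw hP hP, inner4 ha hb hzw hzw' hP hR,
      inner4 ha hb hzw' hzw hR hP, inner4 ha hb hzw' hzw' hR hR, inner4 hc hd hzw hzw hP hP,
      inner4 hc hd hzw hzw' hP hR, inner4 hc hd hzw' hzw hR hP, inner4 hc hd hzw' hzw' hR hR,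
      inner_mm ha hzw, inner_mm ha hzw', inner_mm hb hzw, inner_mm hb hzw',
      inner_mm hc hzw, inner_mm hc hzw', inner_mm hd hzw, inner_mm hd hzw',
      inner_pp hP hP, inner_pp hP hR, inner_pp hR hP, inner_pp hR hR]
    simp
    ring
  rw [LinearMap.add_apply, inner_add_left, F_part, τ_part]
  have expand : 2 * ((w.re - w'.im) ^ 2 + (w.im + w'.re) ^ 2 + (z.re + z'.im) ^ 2
        + (z.im - z'.re) ^ 2)
      + 4 * (w.re * w'.im - w.im * w'.re - z.re * z'.im + z.im * z'.re)
      = ⟪A, A⟫_ℝ + ⟪B, B⟫_ℝ := by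
    rw [inner_mm hzw hzw, inner_mm hzw' hzw']
    ring
  rw [expand]
  by_cases hA0 : A = 0
  · have hB0 : B ≠ 0 := by
      rintro rfl
      simp [hA0] at hσ0
    exact add_pos_of_nonneg_of_pos real_inner_self_nonneg (real_inner_self_pos.2 hB0)
  · exact add_pos_of_pos_of_nonneg (real_inner_self_pos.2 hA0) real_inner_self_nonneg
end
end

section
/- Strong fatness for the Aloff–Wallach spaces W⁷_{k,ℓ}: let g = su(3) (traceless skew-Hermitian complex 3×3 matrices) with inner product Q(X,Y) = −Re tr(XY), let k = {diag(A, −tr A) : A ∈ u(2)} (u(2) embedded in the upper-left 2×2 block), and for real numbers k, ℓ with 0 < k ≤ ℓ let h = ℝ·diag(ki, ℓi, −(k+ℓ)i) ⊂ k. Let m be the Q-orthogonal complement of k in g and p the Q-orthogonal complement of h in k. Then there exists τ ∈ Λ²m⊗Λ²p such that the operator F + τ restricted to m⊗p is positive-definite. -/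
/- Common setup: an abstract model of the second and fourth exterior powers
`Λ²V` and `Λ⁴V` of a real inner product space `V`, with the induced inner
products, the identification of 4-vectors with self-adjoint operators on
`Λ²V`, and the Bianchi map. -/

noncomputable section

open scoped InnerProductSpace

namespace ExtModel

variable {V E2 E4 : Type*} [NormedAddCommGroup V] [InnerProductSpace ℝ V]
  [NormedAddCommGroup E2] [InnerProductSpace ℝ E2]
  [NormedAddCommGroup E4] [InnerProductSpace ℝ E4]

/-- The operator of `X ∧ Y ∧ Z ∧ W` paired with mixed bivectors, when `X, Y` are orthogonal
to `P, R` and `Z, W` are orthogonal to `x, y`. -/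
lemma inner_toOp_wedge4_mixed (M : ExtModel V E2 E4) {X Y Z W x y P R : V}
    (hXP : ⟪X, P⟫_ℝ = 0) (hXR : ⟪X, R⟫_ℝ = 0) (hYP : ⟪Y, P⟫_ℝ = 0) (hYR : ⟪Y, R⟫_ℝ = 0)
    (hZx : ⟪Z, x⟫_ℝ = 0) (hZy : ⟪Z, y⟫_ℝ = 0) (hWx : ⟪W, x⟫_ℝ = 0) (hWy : ⟪W, y⟫_ℝ = 0) :
    ⟪M.toOp (M.wedge4 X Y Z W) (M.wedge2 x P), M.wedge2 y R⟫_ℝ =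
      -((⟪X, x⟫_ℝ * ⟪Y, y⟫_ℝ - ⟪X, y⟫_ℝ * ⟪Y, x⟫_ℝ) *
        (⟪Z, P⟫_ℝ * ⟪W, R⟫_ℝ - ⟪Z, R⟫_ℝ * ⟪W, P⟫_ℝ)) := by
  rw [M.toOp_spec]
  have h := M.inner_wedge4 ![X, Y, Z, W] ![x, P, y, R]
  simp only [Matrix.cons_val] at h
  rw [h, Matrix.det_succ_row_zero]
  simp [Fin.sum_univ_succ, Matrix.det_fin_three, Fin.succAbove, hXP, hXR, hYP, hYR, hZx, hZy,
    hWx, hWy]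
  ring

end ExtModel

/-- The element of `su(3)` orthogonal to `u(2)` with upper right column
`(a + b i, c + d i)`. -/
def offBlock (a b c d : ℝ) : Matrix (Fin 3) (Fin 3) ℂ :=
  !![0, 0, ⟨a, b⟩; 0, 0, ⟨c, d⟩; ⟨-a, b⟩, ⟨-c, d⟩, 0]

/-- The element of `u(2) ⊆ su(3)` with diagonal `(a i, b i, -(a + b) i)` and
`(0, 1)` entry `r + s i`. -/
def inBlock (a b r s : ℝ) : Matrix (Fin 3) (Fin 3) ℂ :=
  !![⟨0, a⟩, ⟨r, s⟩, 0; ⟨-r, s⟩, ⟨0, b⟩, 0; 0, 0, ⟨0, -(a + b)⟩]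

open Matrix in
lemma offBlock_mem_su (a b c d : ℝ) :
    (offBlock a b c d)ᴴ = -offBlock a b c d ∧ (offBlock a b c d).trace = 0 := by
  constructor
  · ext i j
    fin_cases i <;> fin_cases j <;> simp [offBlock, Complex.ext_iff]
  · simp [offBlock, Matrix.trace_fin_three]

open Matrix in
lemma inBlock_mem_su (a b r s : ℝ) :
    (inBlock a b r s)ᴴ = -inBlock a b r s ∧ (inBlock a b r s).trace = 0 := by
  constructor
  · ext i j
    fin_cases i <;> fin_cases j <;> simp [inBlock, Complex.ext_iff]
  · simp [inBlock, Matrix.trace_fin_three, Complex.ext_iff]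

lemma re_trace_offBlock_mul_offBlock (a b c d a' b' c' d' : ℝ) :
    -(Matrix.trace (offBlock a b c d * offBlock a' b' c' d')).re =
      2 * (a * a' + b * b' + c * c' + d * d') := by
  simp [offBlock, Matrix.trace_fin_three]
  ring

lemma re_trace_inBlock_mul_inBlock (a b r s a' b' r' s' : ℝ) :
    -(Matrix.trace (inBlock a b r s * inBlock a' b' r' s')).re =
      a * a' + b * b' + (a + b) * (a' + b') + 2 * (r * r' + s * s') := by
  simp [inBlock, Matrix.trace_fin_three]
  ring

lemma re_trace_offBlock_mul_inBlock (a b c d a' b' r s : ℝ) :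
    -(Matrix.trace (offBlock a b c d * inBlock a' b' r s)).re = 0 := by
  simp [offBlock, inBlock, Matrix.trace_fin_three]

lemma re_trace_inBlock_mul_offBlock (a b c d a' b' r s : ℝ) :
    -(Matrix.trace (inBlock a' b' r s * offBlock a b c d)).re = 0 := by
  rw [Matrix.trace_mul_comm, re_trace_offBlock_mul_inBlock]

lemma inBlock_add (a b r s a' b' r' s' : ℝ) :
    inBlock a b r s + inBlock a' b' r' s' = inBlock (a + a') (b + b') (r + r') (s + s') := by
  ext i j
  fin_cases i <;> fin_cases j <;> simp [inBlock, Complex.ext_iff] <;> ring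

lemma smul_inBlock (t a b r s : ℝ) :
    t • inBlock a b r s = inBlock (t * a) (t * b) (t * r) (t * s) := by
  ext i j
  fin_cases i <;> fin_cases j <;> simp [inBlock, Complex.ext_iff] <;> ring

/-- The bracket of `u(2)` on its complement: `[X_z, A] = -X_{(A + tr A) z}`. -/
lemma offBlock_commutator_inBlock (a b c d p q r s : ℝ) :
    offBlock a b c d * inBlock p q r s - inBlock p q r s * offBlock a b c d =
      offBlock ((2 * p + q) * b - (r * c - s * d)) (-((2 * p + q) * a) - (r * d + s * c))
        ((p + 2 * q) * d + (r * a + s * b)) (-((p + 2 * q) * c) + (r * b - s * a)) := by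
  ext i j
  fin_cases i <;> fin_cases j <;>
    simp [offBlock, inBlock, Complex.ext_iff] <;>
    constructor <;> ring

open Matrix in
lemma exists_eq_inBlock {A : Matrix (Fin 3) (Fin 3) ℂ} (hA : Aᴴ = -A) (htr : A.trace = 0)
    (h02 : A 0 2 = 0) (h12 : A 1 2 = 0) : ∃ a b r s : ℝ, A = inBlock a b r s := by
  have h : ∀ i j, star (A j i) = -A i j := fun i j => congrFun (congrFun hA i) j
  have h00 := h 0 0
  have h11 := h 1 1
  have h22 := h 2 2
  have h10 := h 1 0
  have h20 := h 2 0
  have h21 := h 2 1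
  rw [Matrix.trace_fin_three] at htr
  simp only [Complex.ext_iff, Complex.star_def, Complex.conj_re, Complex.conj_im,
    Complex.neg_re, Complex.neg_im, Complex.add_re, Complex.add_im, Complex.zero_re,
    Complex.zero_im] at *
  refine ⟨(A 0 0).im, (A 1 1).im, (A 0 1).re, (A 0 1).im, ?_⟩
  ext i j
  fin_cases i <;> fin_cases j <;> simp [inBlock, Complex.ext_iff] <;> grind

open Matrix in
lemma exists_sub_offBlock_eq_inBlock {A : Matrix (Fin 3) (Fin 3) ℂ} (hA : Aᴴ = -A)
    (htr : A.trace = 0) :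
    ∃ a b c d p q r s : ℝ, A - offBlock a b c d = inBlock p q r s := by
  obtain ⟨ho, hot⟩ := offBlock_mem_su (A 0 2).re (A 0 2).im (A 1 2).re (A 1 2).im
  refine ⟨(A 0 2).re, (A 0 2).im, (A 1 2).re, (A 1 2).im, exists_eq_inBlock ?_ ?_ ?_ ?_⟩
  · rw [conjTranspose_sub, hA, ho]; abel
  · rw [trace_sub, htr, hot, sub_zero]
  · simp [offBlock]
  · simp [offBlock]

lemma eq_zero_of_sum_four_sq_eq_zero {a b c d : ℝ} (h : a ^ 2 + b ^ 2 + c ^ 2 + d ^ 2 = 0) :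
    a = 0 ∧ b = 0 ∧ c = 0 ∧ d = 0 := by
  have ha := sq_nonneg a
  have hb := sq_nonneg b
  have hc := sq_nonneg c
  have hd := sq_nonneg d
  refine ⟨?_, ?_, ?_, ?_⟩ <;> exact pow_eq_zero_iff two_ne_zero |>.1 (by linarith)

/-- The quadratic form of `F + τ` in coordinates is positive-definite. -/
lemma fatness_form_pos {k l u : ℝ} (hk : 0 < k) (hl : 0 < l) (hu : u ^ 2 < 1)
    {a₁ a₂ a₃ a₄ b₁ b₂ b₃ b₄ c₁ c₂ c₃ c₄ : ℝ}
    (h : ¬ ((a₁ = 0 ∧ a₂ = 0 ∧ a₃ = 0 ∧ a₄ = 0) ∧ (b₁ = 0 ∧ b₂ = 0 ∧ b₃ = 0 ∧ b₄ = 0) ∧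
      (c₁ = 0 ∧ c₂ = 0 ∧ c₃ = 0 ∧ c₄ = 0))) :
    0 < (l * a₁ + u * (b₄ + c₃)) ^ 2 + (l * a₂ + u * (c₄ - b₃)) ^ 2 +
      (k * a₃) ^ 2 + (k * a₄) ^ 2 + (b₁ ^ 2 + b₂ ^ 2 + c₁ ^ 2 + c₂ ^ 2) +
      (1 - u ^ 2) * (b₃ ^ 2 + b₄ ^ 2 + c₃ ^ 2 + c₄ ^ 2) := by
  have ht : 0 < 1 - u ^ 2 := sub_pos.2 hu
  generalize 1 - u ^ 2 = t at ht
  have h1 : 0 ≤ (l * a₁ + u * (b₄ + c₃)) ^ 2 + (l * a₂ + u * (c₄ - b₃)) ^ 2 +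
      (k * a₃) ^ 2 + (k * a₄) ^ 2 := by positivity
  have h2 : 0 ≤ b₁ ^ 2 + b₂ ^ 2 + c₁ ^ 2 + c₂ ^ 2 := by positivity
  have h3 : 0 ≤ t * (b₃ ^ 2 + b₄ ^ 2 + c₃ ^ 2 + c₄ ^ 2) := by positivity
  by_contra hneg
  apply h
  obtain ⟨rfl, rfl, rfl, rfl⟩ := eq_zero_of_sum_four_sq_eq_zero
    (show b₁ ^ 2 + b₂ ^ 2 + c₁ ^ 2 + c₂ ^ 2 = 0 by linarith)
  obtain ⟨rfl, rfl, rfl, rfl⟩ := eq_zero_of_sum_four_sq_eq_zero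
    ((mul_eq_zero.1 (show t * (b₃ ^ 2 + b₄ ^ 2 + c₃ ^ 2 + c₄ ^ 2) = 0 by
      linarith)).resolve_left ht.ne')
  have h4 := eq_zero_of_sum_four_sq_eq_zero (show (l * a₁ + u * (0 + 0)) ^ 2 +
    (l * a₂ + u * (0 - 0)) ^ 2 + (k * a₃) ^ 2 + (k * a₄) ^ 2 = 0 by linarith)
  simpa [hk.ne', hl.ne'] using h4

open Matrix in
/-- Strong fatness for the Aloff–Wallach spaces
`W⁷_{k,ℓ} = SU(3)/S¹_{k,ℓ}`. Here `g` is (isomorphic, via `φ`, to) the Lie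
algebra `su(3)` with inner product `Q(X,Y) = −Re tr(XY)` and bracket
`[X,Y] = XY − YX`; `K` corresponds to `u(2) = {diag(A, −tr A) : A ∈ u(2)}`
(upper-left `2×2` block) and, for real numbers `0 < k ≤ ℓ`, `H ⊆ K` to the
line `ℝ·diag(k i, ℓ i, −(k+ℓ) i)`; `m = Kᗮ` and `p = Hᗮ ⊓ K` are the
`Q`-orthogonal complements of `K` in `g` and of `H` in `K`. Conclusion: there
exists `τ ∈ Λ²m⊗Λ²p` such that `F + τ` restricted to `m⊗p` is
positive-definite, where `⟪F(X∧Y), Z∧W⟫ = ⟪[X,Y],[Z,W]⟫` for `X,Z ∈ m`,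
`Y,W ∈ p`. -/
theorem strong_fatness_aloff_wallach
    {g : Type*} [NormedAddCommGroup g] [InnerProductSpace ℝ g] [FiniteDimensional ℝ g]
    (br : g →ₗ[ℝ] g →ₗ[ℝ] g)
    (φ : g →ₗ[ℝ] Matrix (Fin 3) (Fin 3) ℂ)
    (hφ_inj : Function.Injective φ)
    (hφ_range : ∀ A : Matrix (Fin 3) (Fin 3) ℂ,
      (∃ X : g, φ X = A) ↔ (Aᴴ = -A ∧ Matrix.trace A = 0))
    (hφ_br : ∀ X Y : g, φ (br X Y) = φ X * φ Y - φ Y * φ X)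
    (hQ : ∀ X Y : g, ⟪X, Y⟫_ℝ = -(Matrix.trace (φ X * φ Y)).re)
    (k ℓ : ℝ) (hk : 0 < k) (hkl : k ≤ ℓ)
    (K H : Submodule ℝ g)
    (hK : ∀ X : g, X ∈ K ↔
      ((φ X) 0 2 = 0 ∧ (φ X) 1 2 = 0 ∧ (φ X) 2 0 = 0 ∧ (φ X) 2 1 = 0))
    (hH : ∀ X : g, X ∈ H ↔ ∃ t : ℝ, φ X = t • Matrix.diagonal
      ![(k : ℂ) * Complex.I, (ℓ : ℂ) * Complex.I, -((k : ℂ) + (ℓ : ℂ)) * Complex.I])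
    {E2 E4 : Type*}
    [NormedAddCommGroup E2] [InnerProductSpace ℝ E2] [FiniteDimensional ℝ E2]
    [NormedAddCommGroup E4] [InnerProductSpace ℝ E4] [FiniteDimensional ℝ E4]
    (M : ExtModel g E2 E4)
    (F : E2 →ₗ[ℝ] E2)
    (hF : ∀ X Z : g, X ∈ Kᗮ → Z ∈ Kᗮ → ∀ Y W : g, Y ∈ Hᗮ ⊓ K → W ∈ Hᗮ ⊓ K →
      ⟪F (M.wedge2 X Y), M.wedge2 Z W⟫_ℝ = ⟪br X Y, br Z W⟫_ℝ) :
    ∃ τ ∈ Submodule.span ℝ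
        {ω : E4 | ∃ X Y Z W : g, X ∈ Kᗮ ∧ Y ∈ Kᗮ ∧ Z ∈ Hᗮ ⊓ K ∧ W ∈ Hᗮ ⊓ K ∧
          ω = M.wedge4 X Y Z W},
      ∀ σ ∈ Submodule.span ℝ
          {σ : E2 | ∃ X Y : g, X ∈ Kᗮ ∧ Y ∈ Hᗮ ⊓ K ∧ σ = M.wedge2 X Y},
        σ ≠ 0 → 0 < ⟪(F + M.toOp τ) σ, σ⟫_ℝ := by

  have hl : 0 < ℓ := hk.trans_le hkl
  obtain ⟨u, hu⟩ : ∃ u, k = ℓ * (1 - u) := ⟨(ℓ - k) / ℓ, by field_simp; ring⟩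
  have hu1 : u < 1 := by
    rw [hu] at hk
    linarith [(mul_pos_iff_of_pos_left hl).1 hk]
  have hu0 : 0 ≤ u := by nlinarith
  have huu : u ^ 2 < 1 := by nlinarith
  choose m hm using fun a b c d : ℝ => (hφ_range _).2 (offBlock_mem_su a b c d)
  choose n hn using fun a b r s : ℝ => (hφ_range _).2 (inBlock_mem_su a b r s)
  have hmm (a b c d a' b' c' d' : ℝ) :
      ⟪m a b c d, m a' b' c' d'⟫_ℝ = 2 * (a * a' + b * b' + c * c' + d * d') := by
    rw [hQ, hm, hm, re_trace_offBlock_mul_offBlock]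
  have hmn (a b c d p q r s : ℝ) : ⟪m a b c d, n p q r s⟫_ℝ = 0 := by
    rw [hQ, hm, hn, re_trace_offBlock_mul_inBlock]
  have hnm (a b c d p q r s : ℝ) : ⟪n p q r s, m a b c d⟫_ℝ = 0 := by
    rw [real_inner_comm, hmn]
  have hnn (p q r s p' q' r' s' : ℝ) : ⟪n p q r s, n p' q' r' s'⟫_ℝ =
      p * p' + q * q' + (p + q) * (p' + q') + 2 * (r * r' + s * s') := by
    rw [hQ, hn, hn, re_trace_inBlock_mul_inBlock]
  have hnK (p q r s : ℝ) : n p q r s ∈ K := by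
    rw [hK, hn]; simp [inBlock]
  have hKn {X : g} (hX : X ∈ K) : ∃ p q r s, X = n p q r s := by
    obtain ⟨h1, h2⟩ := (hφ_range _).1 ⟨X, rfl⟩
    obtain ⟨h3, h4, -, -⟩ := (hK X).1 hX
    obtain ⟨p, q, r, s, h⟩ := exists_eq_inBlock h1 h2 h3 h4
    exact ⟨p, q, r, s, hφ_inj (by rw [h, hn])⟩
  have hmK (a b c d : ℝ) : m a b c d ∈ Kᗮ := by
    rw [Submodule.mem_orthogonal']
    intro Y hY
    obtain ⟨p, q, r, s, rfl⟩ := hKn hY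
    exact hmn ..
  have hKm {X : g} (hX : X ∈ Kᗮ) : ∃ a b c d, X = m a b c d := by
    obtain ⟨h1, h2⟩ := (hφ_range _).1 ⟨X, rfl⟩
    obtain ⟨a, b, c, d, p, q, r, s, h⟩ := exists_sub_offBlock_eq_inBlock h1 h2
    refine ⟨a, b, c, d, sub_eq_zero.1 ?_⟩
    have hX' : X - m a b c d = n p q r s := hφ_inj (by rw [map_sub, hm, hn, h])
    have h3 : X - m a b c d ∈ Kᗮ := sub_mem hX (hmK _ _ _ _)
    exact inner_self_eq_zero.1 (Submodule.inner_right_of_mem_orthogonal (hX' ▸ hnK p q r s) h3)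
  have hHn {X : g} : X ∈ H ↔ ∃ t, X = n (t * k) (t * ℓ) 0 0 := by
    rw [hH]
    refine exists_congr fun t => ?_
    rw [← hφ_inj.eq_iff, hn]
    have : t • Matrix.diagonal ![(k : ℂ) * Complex.I, (ℓ : ℂ) * Complex.I,
        -((k : ℂ) + (ℓ : ℂ)) * Complex.I] = inBlock (t * k) (t * ℓ) 0 0 := by
      ext i j
      fin_cases i <;> fin_cases j <;> simp [inBlock, Complex.ext_iff] <;> ring
    rw [this]
  set p := (k + 2 * ℓ) / 3 with hp
  set q := -(2 * k + ℓ) / 3 with hq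
  have hpp {r s δ : ℝ} : n (δ * p) (δ * q) r s ∈ Hᗮ ⊓ K := by
    refine ⟨(Submodule.mem_orthogonal' _ _).2 fun Y hY => ?_, hnK ..⟩
    obtain ⟨t, rfl⟩ := hHn.1 hY
    rw [hnn, hp, hq]
    ring
  have hn_lin (p q r s p' q' r' s' : ℝ) :
      n p q r s + n p' q' r' s' = n (p + p') (q + q') (r + r') (s + s') := by
    apply hφ_inj
    rw [map_add, hn, hn, hn, inBlock_add]
  have hn_smul (t p q r s : ℝ) : t • n p q r s = n (t * p) (t * q) (t * r) (t * s) := by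
    apply hφ_inj
    rw [map_smul, hn, hn, smul_inBlock]
  have hE₁ : n p q 0 0 ∈ Hᗮ ⊓ K := by simpa using hpp (r := 0) (s := 0) (δ := 1)
  have hE₂ : n 0 0 1 0 ∈ Hᗮ ⊓ K := by simpa using hpp (r := 1) (s := 0) (δ := 0)
  have hE₃ : n 0 0 0 1 ∈ Hᗮ ⊓ K := by simpa using hpp (r := 0) (s := 1) (δ := 0)
  have hpn {Y : g} (hY : Y ∈ Hᗮ ⊓ K) :
      ∃ δ r s : ℝ, Y = δ • n p q 0 0 + r • n 0 0 1 0 + s • n 0 0 0 1 := by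
    obtain ⟨x, y, r, s, rfl⟩ := hKn hY.2
    have hD : 0 < ℓ ^ 2 + k * ℓ + k ^ 2 := by positivity
    obtain ⟨δ, t, hx, hy⟩ : ∃ δ t, x = δ * p + t * k ∧ y = δ * q + t * ℓ := by
      refine ⟨3 * (ℓ * x - k * y) / (2 * (ℓ ^ 2 + k * ℓ + k ^ 2)),
        ((2 * k + ℓ) * x + (k + 2 * ℓ) * y) / (2 * (ℓ ^ 2 + k * ℓ + k ^ 2)), ?_, ?_⟩
      · rw [hp]; field_simp; ring
      · rw [hq]; field_simp; ring
    refine ⟨δ, r, s, ?_⟩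
    have h1 : n x y r s = n (δ * p) (δ * q) r s + n (t * k) (t * ℓ) 0 0 := by
      rw [hn_lin, hx, hy, add_zero, add_zero]
    have h2 : n (t * k) (t * ℓ) 0 0 ∈ Hᗮ := by
      rw [eq_sub_of_add_eq' h1.symm]
      exact sub_mem hY.1 hpp.1
    have h3 : n (t * k) (t * ℓ) 0 0 = 0 :=
      inner_self_eq_zero.1 (Submodule.inner_right_of_mem_orthogonal (hHn.2 ⟨t, rfl⟩) h2)
    rw [h1, h3, hn_smul, hn_smul, hn_smul, hn_lin, hn_lin]
    simp
  have hσ {σ : E2} (h : σ ∈ Submodule.span ℝ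
      {σ : E2 | ∃ X Y : g, X ∈ Kᗮ ∧ Y ∈ Hᗮ ⊓ K ∧ σ = M.wedge2 X Y}) :
      ∃ x ∈ Kᗮ, ∃ y ∈ Kᗮ, ∃ z ∈ Kᗮ, σ = M.wedge2 x (n p q 0 0) + M.wedge2 y (n 0 0 1 0) +
        M.wedge2 z (n 0 0 0 1) := by
    induction h using Submodule.span_induction with
    | mem σ h =>
      obtain ⟨X, Y, hX, hY, rfl⟩ := h
      obtain ⟨δ, r, s, rfl⟩ := hpn hY
      exact ⟨δ • X, Kᗮ.smul_mem _ hX, r • X, Kᗮ.smul_mem _ hX, s • X, Kᗮ.smul_mem _ hX, by simp⟩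
    | zero => exact ⟨0, zero_mem _, 0, zero_mem _, 0, zero_mem _, by simp⟩
    | add σ σ' _ _ h h' =>
      obtain ⟨x, hx, y, hy, z, hz, rfl⟩ := h
      obtain ⟨x', hx', y', hy', z', hz', rfl⟩ := h'
      refine ⟨x + x', add_mem hx hx', y + y', add_mem hy hy', z + z', add_mem hz hz', ?_⟩
      simp only [map_add, LinearMap.add_apply]
      abel
    | smul t σ _ h =>
      obtain ⟨x, hx, y, hy, z, hz, rfl⟩ := h
      exact ⟨t • x, Kᗮ.smul_mem _ hx, t • y, Kᗮ.smul_mem _ hy, t • z, Kᗮ.smul_mem _ hz, by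
        simp⟩
  have hbr (a b c d p q r s : ℝ) : br (m a b c d) (n p q r s) =
      m ((2 * p + q) * b - (r * c - s * d)) (-((2 * p + q) * a) - (r * d + s * c))
        ((p + 2 * q) * d + (r * a + s * b)) (-((p + 2 * q) * c) + (r * b - s * a)) := by
    apply hφ_inj
    rw [hφ_br, hm, hn, hm, offBlock_commutator_inBlock]
  have hT (a b c d a' b' c' d' p q r s p' q' r' s' x₁ x₂ x₃ x₄ y₁ y₂ y₃ y₄ e₁ e₂ e₃ e₄
      f₁ f₂ f₃ f₄ : ℝ) :=
    M.inner_toOp_wedge4_mixed (hmn a b c d e₁ e₂ e₃ e₄) (hmn a b c d f₁ f₂ f₃ f₄)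
      (hmn a' b' c' d' e₁ e₂ e₃ e₄) (hmn a' b' c' d' f₁ f₂ f₃ f₄)
      (hnm x₁ x₂ x₃ x₄ p q r s) (hnm y₁ y₂ y₃ y₄ p q r s)
      (hnm x₁ x₂ x₃ x₄ p' q' r' s') (hnm y₁ y₂ y₃ y₄ p' q' r' s')
  simp only [hmm, hnn] at hT
  obtain ⟨t, ht⟩ : ∃ t, t * (p ^ 2 + q ^ 2 + (p + q) ^ 2) = k / 4 := by
    have : 0 < p := by positivity
    exact ⟨k / 4 / (p ^ 2 + q ^ 2 + (p + q) ^ 2), div_mul_cancel₀ _ (by positivity)⟩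
  refine ⟨t • M.wedge4 (m 1 0 0 0) (m 0 0 0 1) (n p q 0 0) (n 0 0 1 0)
    - t • M.wedge4 (m 0 1 0 0) (m 0 0 1 0) (n p q 0 0) (n 0 0 1 0)
    + t • M.wedge4 (m 1 0 0 0) (m 0 0 1 0) (n p q 0 0) (n 0 0 0 1)
    + t • M.wedge4 (m 0 1 0 0) (m 0 0 0 1) (n p q 0 0) (n 0 0 0 1)
    + (1 / 8 : ℝ) • M.wedge4 (m 1 0 0 0) (m 0 1 0 0) (n 0 0 1 0) (n 0 0 0 1)
    - ((1 - u ^ 2) / 8) • M.wedge4 (m 0 0 1 0) (m 0 0 0 1) (n 0 0 1 0) (n 0 0 0 1), ?_, ?_⟩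
  · have hτ {a b c d a' b' c' d' : ℝ} {Z W : g} (hZ : Z ∈ Hᗮ ⊓ K) (hW : W ∈ Hᗮ ⊓ K) (t : ℝ) :
        t • M.wedge4 (m a b c d) (m a' b' c' d') Z W ∈ Submodule.span ℝ
          {ω : E4 | ∃ X Y Z W : g, X ∈ Kᗮ ∧ Y ∈ Kᗮ ∧ Z ∈ Hᗮ ⊓ K ∧ W ∈ Hᗮ ⊓ K ∧
            ω = M.wedge4 X Y Z W} :=
      Submodule.smul_mem _ _ (Submodule.subset_span ⟨_, _, _, _, hmK _ _ _ _, hmK _ _ _ _, hZ, hW, rfl⟩)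
    exact sub_mem (add_mem (add_mem (add_mem (sub_mem (hτ hE₁ hE₂ t) (hτ hE₁ hE₂ t))
      (hτ hE₁ hE₃ t)) (hτ hE₁ hE₃ t)) (hτ hE₂ hE₃ _)) (hτ hE₂ hE₃ _)
  · intro σ hmem hne
    obtain ⟨x, hx, y, hy, z, hz, rfl⟩ := hσ hmem
    obtain ⟨a₁, a₂, a₃, a₄, rfl⟩ := hKm hx
    obtain ⟨b₁, b₂, b₃, b₄, rfl⟩ := hKm hy
    obtain ⟨c₁, c₂, c₃, c₄, rfl⟩ := hKm hz
    have hm0 : m 0 0 0 0 = 0 := inner_self_eq_zero.1 (by rw [hmm]; ring)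
    have hpos := fatness_form_pos hk hl huu (a₁ := a₁) (a₂ := a₂) (a₃ := a₃) (a₄ := a₄)
      (b₁ := b₁) (b₂ := b₂) (b₃ := b₃) (b₄ := b₄) (c₁ := c₁) (c₂ := c₂) (c₃ := c₃) (c₄ := c₄) (by
        rintro ⟨⟨rfl, rfl, rfl, rfl⟩, ⟨rfl, rfl, rfl, rfl⟩, rfl, rfl, rfl, rfl⟩
        exact hne (by simp [hm0]))
    rw [LinearMap.add_apply, inner_add_left]
    have hFσ : ⟪F (M.wedge2 (m a₁ a₂ a₃ a₄) (n p q 0 0) + M.wedge2 (m b₁ b₂ b₃ b₄) (n 0 0 1 0) +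
        M.wedge2 (m c₁ c₂ c₃ c₄) (n 0 0 0 1)), M.wedge2 (m a₁ a₂ a₃ a₄) (n p q 0 0) +
        M.wedge2 (m b₁ b₂ b₃ b₄) (n 0 0 1 0) + M.wedge2 (m c₁ c₂ c₃ c₄) (n 0 0 0 1)⟫_ℝ =
        2 * ((ℓ * a₂ - b₃ + c₄) ^ 2 + (-(ℓ * a₁) - b₄ - c₃) ^ 2 +
          (-(k * a₄) + b₁ + c₂) ^ 2 + (k * a₃ + b₂ - c₁) ^ 2) := by
      simp only [map_add, inner_add_left, inner_add_right, hF _ _ hx hx _ _ hE₁ hE₁,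
        hF _ _ hx hy _ _ hE₁ hE₂, hF _ _ hx hz _ _ hE₁ hE₃, hF _ _ hy hx _ _ hE₂ hE₁,
        hF _ _ hy hy _ _ hE₂ hE₂, hF _ _ hy hz _ _ hE₂ hE₃, hF _ _ hz hx _ _ hE₃ hE₁,
        hF _ _ hz hy _ _ hE₃ hE₂, hF _ _ hz hz _ _ hE₃ hE₃, hbr, hmm]
      rw [hp, hq]
      ring
    rw [hFσ]
    simp only [map_add, map_sub, map_smul, LinearMap.add_apply, LinearMap.sub_apply,
      LinearMap.smul_apply, inner_add_left, inner_add_right, inner_sub_left,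
      real_inner_smul_left, hT]
    refine (mul_pos two_pos hpos).trans_eq ?_
    linear_combination 16 * (a₁ * b₄ + a₁ * c₃ + a₂ * c₄ - a₂ * b₃ + a₃ * b₂ - a₃ * c₁ - a₄ * b₁ -
      a₄ * c₂) * ht + 4 * (a₁ * b₄ + a₁ * c₃ + a₂ * c₄ - a₂ * b₃) * hu
end
end
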